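/- Let 1 < p = q ≤ 2 and T > 0, and for λ > 0 let S_λ denote the set of all classical solutions of (φ_p(u'))' + λ·φ_p(u)·(1−|u|^p) = 0 on (0,T) with u(0) = u(T) = 0. If 0 < λ ≤ (p/p*)·(π_{pp}/T)^p then S_λ = {0}. If (p/p*)·(nπ_{pp}/T)^p < λ ≤ (p/p*)·((n+1)π_{pp}/T)^p for some n ∈ ℕ (n ≥ 1), then there exists a strictly decreasing sequence k_1 > k_2 > ⋯ > k_n in (0,1) such that S_λ = {0} ∪ ⋃_{j=1}^n {u_{j,k_j}, −u_{j,k_j}}, where each k_j is the unique solution in (0,1) of λ = (p/p*)·(1+k^p)·(2k^p/(1+k^p))^{p/p−1}·(2jK_{pp}(k)/T)^p and u_{j,k_j}(t) = (2k_j^p/(1+k_j^p))^{1/p}·sn_{pp}(2jK_{pp}(k_j)t/T, k_j). -/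

import Mathlib

open Real Set Filter MeasureTheory

/-- Generalized arcsine: `arcsin_{pq}(σ) = ∫_0^σ (1 - s^q)^(-1/p) ds`. -/
noncomputable def arcsinPQ (p q σ : ℝ) : ℝ :=
  ∫ s in (0:ℝ)..σ, (1 - s ^ q) ^ (-(1 / p))

/-- The generalized half-period `π_{pq} = 2 arcsin_{pq}(1)`. -/
noncomputable def piPQ (p q : ℝ) : ℝ := 2 * arcsinPQ p q 1

/-- Generalized incomplete elliptic integral:
`arcsn_{pq}(σ,k) = ∫_0^σ ((1-s^q)(1-k^q s^q))^(-1/p) ds`. -/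
noncomputable def arcsnPQ (p q k σ : ℝ) : ℝ :=
  ∫ s in (0:ℝ)..σ, ((1 - s ^ q) * (1 - k ^ q * s ^ q)) ^ (-(1 / p))

/-- Generalized complete elliptic integral `K_{pq}(k) = arcsn_{pq}(1,k)`. -/
noncomputable def Kpq (p q k : ℝ) : ℝ := arcsnPQ p q k 1

/-- `φ_m(s) = |s|^(m-2) s` for `s ≠ 0`, `φ_m(0) = 0`. -/
noncomputable def phi (m s : ℝ) : ℝ := if s = 0 then 0 else |s| ^ (m - 2) * s

/-- Incomplete beta function `B̃(a,b,u) = ∫_0^u z^(a-1) (1-z)^(b-1) dz`. -/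
noncomputable def incBeta (a b u : ℝ) : ℝ :=
  ∫ z in (0:ℝ)..u, z ^ (a - 1) * (1 - z) ^ (b - 1)

/-- A classical solution of `(φ_p(u'))' + λ φ_q(u) = 0` on `(0,T)` with
`u(0) = u(T) = 0`: `u ∈ C¹([0,T])`, `t ↦ φ_p(u'(t))` is differentiable on `(0,T)`
and the equation holds at every point of `(0,T)`. -/
def IsSolE (p q T lam : ℝ) (u : ℝ → ℝ) : Prop :=
  ∃ u' : ℝ → ℝ,
    (∀ t ∈ Set.Icc 0 T, HasDerivWithinAt u (u' t) (Set.Icc 0 T) t) ∧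
    ContinuousOn u' (Set.Icc 0 T) ∧
    (∀ t ∈ Set.Ioo 0 T, HasDerivWithinAt (fun s => phi p (u' s))
      (-(lam * phi q (u t))) (Set.Ioo 0 T) t) ∧
    u 0 = 0 ∧ u T = 0

/-- A classical solution of `(φ_p(u'))' + λ φ_q(u)(1 - |u|^q) = 0` on `(0,T)` with
`u(0) = u(T) = 0`. -/
def IsSolP (p q T lam : ℝ) (u : ℝ → ℝ) : Prop :=
  ∃ u' : ℝ → ℝ,
    (∀ t ∈ Set.Icc 0 T, HasDerivWithinAt u (u' t) (Set.Icc 0 T) t) ∧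
    ContinuousOn u' (Set.Icc 0 T) ∧
    (∀ t ∈ Set.Ioo 0 T, HasDerivWithinAt (fun s => phi p (u' s))
      (-(lam * phi q (u t) * (1 - |u t| ^ q))) (Set.Ioo 0 T) t) ∧
    u 0 = 0 ∧ u T = 0

/-- `Φ(k) = (1+k^q)^(1/p) (2k^q/(1+k^q))^(1/q - 1/p) K_{pq}(k)`. -/
noncomputable def PhiFun (p q k : ℝ) : ℝ :=
  (1 + k ^ q) ^ (1 / p) * (2 * k ^ q / (1 + k ^ q)) ^ (1 / q - 1 / p) * Kpq p q k

open scoped Topology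

/-! ### The odd power `phi` -/

theorem phi_eq_mul (m s : ℝ) : phi m s = |s| ^ (m - 2) * s := by
  unfold phi
  split_ifs with h
  · simp [h]
  · rfl

theorem phi_zero (m : ℝ) : phi m 0 = 0 := by simp [phi]

theorem phi_neg (m s : ℝ) : phi m (-s) = -phi m s := by simp [phi_eq_mul]

theorem phi_of_pos {m s : ℝ} (hs : 0 < s) : phi m s = s ^ (m - 1) := by
  rw [phi_eq_mul, abs_of_pos hs]
  nth_rewrite 2 [← Real.rpow_one s]
  rw [← Real.rpow_add hs]
  ring_nf

theorem phi_mul_of_pos {m c : ℝ} (hc : 0 < c) (s : ℝ) :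
    phi m (c * s) = c ^ (m - 1) * phi m s := by
  rw [phi_eq_mul, phi_eq_mul, abs_mul, abs_of_pos hc, Real.mul_rpow hc.le (abs_nonneg s)]
  have : c ^ (m - 1) = c ^ (m - 2) * c := by
    rw [← Real.rpow_add_one hc.ne']; ring_nf
  rw [this]; ring

theorem abs_phi {m : ℝ} (hm : 1 < m) (s : ℝ) : |phi m s| = |s| ^ (m - 1) := by
  rcases eq_or_ne s 0 with rfl | hs
  · simp [phi_zero, Real.zero_rpow (by linarith : m - 1 ≠ 0)]
  · have h := abs_pos.2 hs
    rw [← phi_of_pos h, phi_eq_mul, phi_eq_mul, abs_mul, abs_abs,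
      abs_of_nonneg (Real.rpow_nonneg h.le _)]

theorem phi_conj_phi {p : ℝ} (hp : 1 < p) (s : ℝ) : phi (p / (p - 1)) (phi p s) = s := by
  have hp' : p - 1 ≠ 0 := by linarith
  have key : ∀ s : ℝ, 0 < s → phi (p / (p - 1)) (phi p s) = s := fun s hs => by
    rw [phi_of_pos hs, phi_of_pos (Real.rpow_pos_of_pos hs _), ← Real.rpow_mul hs.le]
    have : (p - 1) * (p / (p - 1) - 1) = 1 := by field_simp; ring
    rw [this, Real.rpow_one]
  rcases lt_trichotomy s 0 with hs | rfl | hs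
  · have := key (-s) (by linarith)
    rw [phi_neg, phi_neg] at this
    linarith
  · simp [phi_zero]
  · exact key s hs

theorem hasDerivAt_abs_rpow_phi {m : ℝ} (hm : 1 < m) (s : ℝ) :
    HasDerivAt (fun x : ℝ => |x| ^ m) (m * phi m s) s := by
  have := hasDerivAt_abs_rpow s hm
  rwa [mul_assoc, ← phi_eq_mul] at this

theorem contDiff_abs_rpow {m : ℝ} (hm : 1 < m) : ContDiff ℝ 1 (fun x : ℝ => |x| ^ m) :=
  contDiff_norm_rpow (E := ℝ) hm

theorem continuous_phi {m : ℝ} (hm : 1 < m) : Continuous (phi m) := by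
  have h := (contDiff_abs_rpow hm).continuous_deriv le_rfl
  have hd : deriv (fun x : ℝ => |x| ^ m) = fun s => m * phi m s :=
    funext fun s => (hasDerivAt_abs_rpow_phi hm s).deriv
  rw [hd] at h
  have := h.const_smul m⁻¹
  refine this.congr fun s => ?_
  have : m ≠ 0 := by linarith
  simp [this]

theorem continuous_abs_rpow {m : ℝ} (hm : 0 ≤ m) : Continuous (fun x : ℝ => |x| ^ m) :=
  continuous_abs.rpow_const fun _ => Or.inr hm

theorem contDiff_phi {m : ℝ} (hm : 2 ≤ m) : ContDiff ℝ 1 (phi m) := by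
  rcases hm.eq_or_lt with rfl | hm
  · have : phi 2 = fun s : ℝ => s := by ext s; simp [phi_eq_mul]
    rw [this]; exact contDiff_id
  have hd : ∀ s, HasDerivAt (phi m) ((m - 1) * |s| ^ (m - 2)) s := by
    have hpos : ∀ s : ℝ, 0 < s → HasDerivAt (phi m) ((m - 1) * |s| ^ (m - 2)) s := fun s hs => by
      have h := Real.hasDerivAt_rpow_const (x := s) (p := m - 1) (Or.inl hs.ne')
      rw [abs_of_pos hs, show m - 2 = m - 1 - 1 by ring]
      refine h.congr_of_eventuallyEq ?_
      filter_upwards [lt_mem_nhds hs] with x hx using phi_of_pos hx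
    intro s
    refine hasDerivAt_of_hasDerivAt_of_ne' (x := 0) (g := fun s => (m - 1) * |s| ^ (m - 2)) ?_
      (continuous_phi (by linarith)).continuousAt
      ((continuous_abs_rpow (by linarith)).const_smul (m - 1)).continuousAt s
    intro y hy
    rcases lt_or_gt_of_ne hy with hy | hy
    · have h := (hpos (-y) (by linarith)).comp y (hasDerivAt_neg y)
      have h2 := h.neg
      simp only [abs_neg, mul_neg, mul_one, neg_neg] at h2
      refine h2.congr_of_eventuallyEq (Eventually.of_forall fun x => ?_)
      simp [phi_neg]
    · exact hpos y hy
  rw [contDiff_one_iff_deriv]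
  refine ⟨fun s => (hd s).differentiableAt, ?_⟩
  rw [funext fun s => (hd s).deriv]
  exact (continuous_abs_rpow (by linarith)).const_smul (m - 1)

theorem contDiffAt_phi {m s : ℝ} (hs : s ≠ 0) : ContDiffAt ℝ 1 (phi m) s := by
  have : phi m = fun s => |s| ^ (m - 2) * s := funext (phi_eq_mul m)
  rw [this]
  exact ((contDiffAt_abs hs).rpow_const_of_ne (abs_ne_zero.2 hs)).mul contDiffAt_id

theorem contDiffAt_potential_deriv {p s : ℝ} (hp : 1 < p) (hs : s ≠ 0) (lam : ℝ) :
    ContDiffAt ℝ 1 (fun s => -(lam * phi p s * (1 - |s| ^ p))) s :=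
  ((contDiffAt_const.mul (contDiffAt_phi hs)).mul
    (contDiffAt_const.sub (contDiff_abs_rpow hp).contDiffAt)).neg

/-! ### Trajectories: forward uniqueness and conservation of energy -/

/-- `u` with velocity `v` solves `(φ_p(u'))' + λ φ_p(u)(1 - |u|^p) = 0` on `[a, b)` in the sense of
right derivatives, and both are continuous up to `b`. -/
structure IsTraj (p lam a b : ℝ) (u v : ℝ → ℝ) : Prop where
  cont_pos : ContinuousOn u (Icc a b)
  cont_vel : ContinuousOn v (Icc a b)
  deriv_pos : ∀ t ∈ Ico a b, HasDerivWithinAt u (v t) (Ici t) t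
  deriv_vel : ∀ t ∈ Ico a b, HasDerivWithinAt (fun s => phi p (v s))
    (-(lam * phi p (u t) * (1 - |u t| ^ p))) (Ici t) t

/-- The energy `|v|^p + λ/(p-1) (|u|^p - |u|^{2p}/2)`. -/
noncomputable def energy (p lam u v : ℝ) : ℝ :=
  |v| ^ p + lam / (p - 1) * (|u| ^ p - (|u| ^ p) ^ 2 / 2)

theorem IsTraj.mono {p lam a b c : ℝ} {u v : ℝ → ℝ} (h : IsTraj p lam a b u v) (hc : a ≤ c) :
    IsTraj p lam c b u v :=
  ⟨h.1.mono (Icc_subset_Icc_left hc), h.2.mono (Icc_subset_Icc_left hc),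
    fun t ht => h.3 t ⟨hc.trans ht.1, ht.2⟩, fun t ht => h.4 t ⟨hc.trans ht.1, ht.2⟩⟩

theorem isTraj_const {p lam a b c : ℝ} (hc : |c| = 1) :
    IsTraj p lam a b (fun _ => c) (fun _ => 0) := by
  refine ⟨continuousOn_const, continuousOn_const, fun t _ => hasDerivWithinAt_const .., ?_⟩
  intro t _
  simpa [hc] using hasDerivWithinAt_const (𝕜 := ℝ) t (Ici t) (phi p 0)

theorem IsTraj.energy_eq {p lam a b : ℝ} {u v : ℝ → ℝ} (hp : 1 < p) (h : IsTraj p lam a b u v) :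
    ∀ t ∈ Icc a b, energy p lam (u t) (v t) = energy p lam (u a) (v a) := by
  have hp1 : p - 1 ≠ 0 := by linarith
  have hq : 1 < p / (p - 1) := by rw [lt_div_iff₀ (by linarith)]; linarith
  have hv : ∀ s, |v s| ^ p = |phi p (v s)| ^ (p / (p - 1)) := fun s => by
    rw [abs_phi hp, ← Real.rpow_mul (abs_nonneg _)]; congr 1; field_simp
  refine constant_of_has_deriv_right_zero ?_ ?_
  · have hu := (continuous_abs_rpow (m := p) (by linarith)).comp_continuousOn h.cont_pos
    have hv := (continuous_abs_rpow (m := p) (by linarith)).comp_continuousOn h.cont_vel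
    exact hv.add (continuousOn_const.mul (hu.sub ((hu.pow 2).div_const 2)))
  · intro t ht
    have h1 := (hasDerivAt_abs_rpow_phi hq (phi p (v t))).comp_hasDerivWithinAt t (h.deriv_vel t ht)
    have h2 := (hasDerivAt_abs_rpow_phi hp (u t)).comp_hasDerivWithinAt t (h.deriv_pos t ht)
    have h3 := h1.add ((h2.sub ((h2.pow 2).div_const 2)).const_mul (lam / (p - 1)))
    refine (h3.congr_deriv ?_).congr_of_mem (fun s _ => ?_) self_mem_Ici
    · rw [phi_conj_phi hp]
      simp only [Function.comp]
      field_simp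
      ring
    · simp [energy, hv s, Function.comp]

theorem IsTraj.eq_zero_of_energy {p lam a b : ℝ} {u v : ℝ → ℝ} (hp : 1 < p) (hlam : 0 < lam)
    (h : IsTraj p lam a b u v) (hu : u a = 0) (hv : v a = 0) : ∀ t ∈ Icc a b, u t = 0 := by
  intro t ht
  by_contra hne
  have hcont : ContinuousOn (fun s => |u s|) (Icc a t) :=
    (h.cont_pos.mono (Icc_subset_Icc_right ht.2)).abs
  have hmem : min |u t| 1 ∈ Icc |u a| |u t| := by
    rw [hu, abs_zero]; exact ⟨le_min (abs_nonneg _) zero_le_one, min_le_left _ _⟩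
  obtain ⟨s, hs, hus⟩ := intermediate_value_Icc ht.1 hcont hmem
  have hpos : 0 < |u s| := by
    simp only at hus; rw [hus]; exact lt_min (abs_pos.2 hne) one_pos
  have hle : |u s| ≤ 1 := by simp only at hus; rw [hus]; exact min_le_right _ _
  have he := h.energy_eq hp s ⟨hs.1, hs.2.trans ht.2⟩
  have hx0 := Real.rpow_pos_of_pos hpos p
  have hx1 := Real.rpow_le_one hpos.le hle (by linarith : (0:ℝ) ≤ p)
  have hv0 := Real.rpow_nonneg (abs_nonneg (v s)) p
  have hmu : 0 < lam / (p - 1) := div_pos hlam (by linarith)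
  have hp0 : p ≠ 0 := by linarith
  simp only [energy, hu, hv, abs_zero, Real.zero_rpow hp0] at he
  have : 0 < |u s| ^ p - (|u s| ^ p) ^ 2 / 2 := by nlinarith
  have := mul_pos hmu this
  linarith

/-- The velocity recovered from the position and the initial speed. -/
theorem contDiffAt_speed {p R : ℝ} (hp : 1 < p) (hR : 0 < R) (mu : ℝ) :
    ContDiffAt ℝ 1 (fun x : ℝ => (R - mu * (|x| ^ p - (|x| ^ p) ^ 2 / 2)) ^ (1 / p)) 0 := by
  have hx := (contDiff_abs_rpow hp).contDiffAt (x := (0 : ℝ))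
  refine ContDiffAt.rpow_const_of_ne
    (contDiffAt_const.sub (contDiffAt_const.mul (hx.sub ((hx.pow 2).div_const 2)))) ?_
  simp [Real.zero_rpow (by linarith : p ≠ 0), hR.ne']

theorem eventually_mem_of_tendsto_Icc {a b : ℝ} {f : ℝ → ℝ} (hab : a < b)
    (hf : ContinuousOn f (Icc a b)) {s : Set ℝ} (hs : s ∈ 𝓝 (f a)) : ∀ᶠ t in 𝓝[≥] a, f t ∈ s := by
  have h := hf a (left_mem_Icc.2 hab.le)
  rw [ContinuousWithinAt, nhdsWithin_Icc_eq_nhdsGE hab] at h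
  exact h hs

theorem exists_Icc_of_eventually_nhdsGE {a b : ℝ} (hab : a < b) {P : ℝ → Prop}
    (h : ∀ᶠ t in 𝓝[≥] a, P t) : ∃ c ∈ Ioc a b, ∀ t ∈ Icc a c, P t := by
  obtain ⟨c, hc, hsub⟩ := mem_nhdsGE_iff_exists_Icc_subset.1 h
  exact ⟨min c b, ⟨lt_min (mem_Ioi.1 hc) hab, min_le_right _ _⟩,
    fun t ht => hsub ⟨ht.1, ht.2.trans (min_le_left _ _)⟩⟩

theorem hasDerivWithinAt_Ici_unique {f g : ℝ → ℝ} {a c f' g' : ℝ} (hac : a < c)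
    (hf : HasDerivWithinAt f f' (Ici a) a) (hg : HasDerivWithinAt g g' (Ici a) a)
    (h : ∀ t ∈ Icc a c, f t = g t) : f' = g' := by
  have hg' : HasDerivWithinAt f g' (Ici a) a := by
    refine hg.congr_of_eventuallyEq ?_ (h a (left_mem_Icc.2 hac.le))
    filter_upwards [Icc_mem_nhdsGE hac] with t ht using h t ht
  exact (uniqueDiffWithinAt_Ici a).eq_deriv _ hf hg'

theorem IsTraj.eq_right_of_pos_eq_zero {p lam a b : ℝ} {u₁ v₁ u₂ v₂ : ℝ → ℝ} (hp : 1 < p)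
    (hab : a < b) (h₁ : IsTraj p lam a b u₁ v₁) (h₂ : IsTraj p lam a b u₂ v₂)
    (hu₁ : u₁ a = 0) (hu₂ : u₂ a = 0) (hv : v₁ a = v₂ a) (hv0 : v₁ a ≠ 0) :
    ∃ c ∈ Ioc a b, ∀ t ∈ Icc a c, u₁ t = u₂ t := by
  set R := |v₁ a| ^ p with hR
  have hRpos : 0 < R := Real.rpow_pos_of_pos (abs_pos.2 hv0) p
  set mu := lam / (p - 1) with hmu
  set sgn := v₁ a / |v₁ a| with hsgn
  have habs : |v₁ a| ≠ 0 := abs_ne_zero.2 hv0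
  set g : ℝ → ℝ := fun x => sgn * (R - mu * (|x| ^ p - (|x| ^ p) ^ 2 / 2)) ^ (1 / p) with hg
  obtain ⟨K, s, hs, hLip⟩ := (contDiffAt_const.mul
    (contDiffAt_speed hp hRpos mu)).exists_lipschitzOnWith (f := g)
  have vel : ∀ u v : ℝ → ℝ, IsTraj p lam a b u v → u a = 0 → v a = v₁ a →
      ∀ᶠ t in 𝓝[≥] a, u t ∈ s ∧ (t ∈ Ico a b → v t = g (u t)) := by
    intro u v h hu hva
    have e1 := eventually_mem_of_tendsto_Icc hab h.cont_pos (s := s) (by rw [hu]; exact hs)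
    have e2 := eventually_mem_of_tendsto_Icc hab h.cont_vel (s := {x | 0 < x * v₁ a})
      (by
        rw [hva]
        exact (isOpen_lt continuous_const (continuous_id.mul continuous_const)).mem_nhds
          (mul_self_pos.2 hv0))
    filter_upwards [e1, e2] with t h1 h2
    refine ⟨h1, fun ht => ?_⟩
    have he := h.energy_eq hp t ⟨ht.1, ht.2.le⟩
    have hp0 : p ≠ 0 := by linarith
    simp only [energy, hu, hva, abs_zero, Real.zero_rpow hp0] at he
    have hab' : |v t| = (R - mu * (|u t| ^ p - (|u t| ^ p) ^ 2 / 2)) ^ (1 / p) := by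
      have : R - mu * (|u t| ^ p - (|u t| ^ p) ^ 2 / 2) = |v t| ^ p := by
        rw [hR]; linarith
      rw [this, one_div, Real.rpow_rpow_inv (abs_nonneg _) hp0]
    rw [hg]
    simp only
    rw [← hab', hsgn]
    replace h2 : 0 < v t * v₁ a := h2
    have h3 : |v t| * |v₁ a| = v t * v₁ a := by rw [← abs_mul, abs_of_pos h2]
    field_simp
    have h4 : |v₁ a| * |v₁ a| = v₁ a * v₁ a := abs_mul_abs_self _
    have : (v t * |v₁ a|) * |v₁ a| = (v₁ a * |v t|) * |v₁ a| := by
      rw [mul_assoc, h4, mul_assoc, h3]; ring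
    exact mul_right_cancel₀ habs this
  obtain ⟨c, hc, hcs⟩ := exists_Icc_of_eventually_nhdsGE hab
    ((vel u₁ v₁ h₁ hu₁ rfl).and (vel u₂ v₂ h₂ hu₂ hv.symm))
  refine ⟨c, hc, ?_⟩
  have key : ∀ t ∈ Ico a c, t ∈ Icc a c ∧ t ∈ Ico a b := fun t ht =>
    ⟨⟨ht.1, ht.2.le⟩, ht.1, ht.2.trans_le hc.2⟩
  refine ODE_solution_unique_of_mem_Icc_right (v := fun _ => g) (s := fun _ => s) (K := K)
    (fun _ _ => hLip) (h₁.cont_pos.mono (Icc_subset_Icc_right hc.2)) ?_ ?_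
    (h₂.cont_pos.mono (Icc_subset_Icc_right hc.2)) ?_ ?_ (hu₁.trans hu₂.symm)
  · intro t ht
    obtain ⟨k1, k2⟩ := key t ht
    rw [← (hcs t k1).1.2 k2]; exact h₁.deriv_pos t k2
  · exact fun t ht => (hcs t (key t ht).1).1.1
  · intro t ht
    obtain ⟨k1, k2⟩ := key t ht
    rw [← (hcs t k1).2.2 k2]; exact h₂.deriv_pos t k2
  · exact fun t ht => (hcs t (key t ht).1).2.1

theorem IsTraj.eq_right_of_pos_ne_zero {p lam a b : ℝ} {u₁ v₁ u₂ v₂ : ℝ → ℝ} (hp : 1 < p)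
    (hp2 : p ≤ 2) (hab : a < b) (h₁ : IsTraj p lam a b u₁ v₁) (h₂ : IsTraj p lam a b u₂ v₂)
    (hu : u₁ a = u₂ a) (hu0 : u₁ a ≠ 0) (hv : v₁ a = v₂ a) :
    ∃ c ∈ Ioc a b, ∀ t ∈ Icc a c, u₁ t = u₂ t := by
  have hq : 2 ≤ p / (p - 1) := by rw [le_div_iff₀ (by linarith)]; linarith
  set X : ℝ × ℝ → ℝ × ℝ := fun z =>
    (phi (p / (p - 1)) z.2, -(lam * phi p z.1 * (1 - |z.1| ^ p))) with hX
  set z₀ : ℝ × ℝ := (u₁ a, phi p (v₁ a)) with hz₀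
  have hX1 : ContDiffAt ℝ 1 X z₀ :=
    ((contDiff_phi hq).contDiffAt.comp z₀ contDiffAt_snd).prodMk
      (ContDiffAt.comp (g := fun s => -(lam * phi p s * (1 - |s| ^ p))) z₀
        (contDiffAt_potential_deriv hp hu0 lam) contDiffAt_fst)
  obtain ⟨K, s, hs, hLip⟩ := hX1.exists_lipschitzOnWith
  have hcont : ∀ u v : ℝ → ℝ, IsTraj p lam a b u v →
      ContinuousOn (fun t => (u t, phi p (v t))) (Icc a b) := fun u v h =>
    h.cont_pos.prodMk ((continuous_phi hp).comp_continuousOn h.cont_vel)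
  have hmem : ∀ u v : ℝ → ℝ, IsTraj p lam a b u v → u a = u₁ a → v a = v₁ a →
      ∀ᶠ t in 𝓝[≥] a, (u t, phi p (v t)) ∈ s := by
    intro u v h hu hv
    have h1 := hcont u v h a (left_mem_Icc.2 hab.le)
    rw [ContinuousWithinAt, nhdsWithin_Icc_eq_nhdsGE hab, hu, hv] at h1
    exact h1 hs
  have hder : ∀ u v : ℝ → ℝ, IsTraj p lam a b u v → ∀ t ∈ Ico a b,
      HasDerivWithinAt (fun t => (u t, phi p (v t))) (X (u t, phi p (v t))) (Ici t) t := by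
    intro u v h t ht
    refine ((h.deriv_pos t ht).prodMk (h.deriv_vel t ht)).congr_deriv ?_
    rw [hX]
    simp only [phi_conj_phi hp]
  obtain ⟨c, hc, hcs⟩ := exists_Icc_of_eventually_nhdsGE hab
    ((hmem u₁ v₁ h₁ rfl rfl).and (hmem u₂ v₂ h₂ hu.symm hv.symm))
  refine ⟨c, hc, ?_⟩
  have hsub : Icc a c ⊆ Icc a b := Icc_subset_Icc_right hc.2
  have := ODE_solution_unique_of_mem_Icc_right (v := fun _ => X) (s := fun _ => s) (K := K)
    (fun _ _ => hLip) ((hcont u₁ v₁ h₁).mono hsub)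
    (fun t ht => hder u₁ v₁ h₁ t (Ico_subset_Ico_right hc.2 ht))
    (fun t ht => (hcs t (Ico_subset_Icc_self ht)).1) ((hcont u₂ v₂ h₂).mono hsub)
    (fun t ht => hder u₂ v₂ h₂ t (Ico_subset_Ico_right hc.2 ht))
    (fun t ht => (hcs t (Ico_subset_Icc_self ht)).2) (by simp only [hu, hv])
  exact fun t ht => congrArg Prod.fst (this ht)

/-- Forward uniqueness for trajectories that do not start at the origin of the phase plane and
have positive energy. -/
theorem IsTraj.unique {p lam a b : ℝ} {u₁ v₁ u₂ v₂ : ℝ → ℝ} (hp : 1 < p) (hp2 : p ≤ 2)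
    (hab : a ≤ b) (h₁ : IsTraj p lam a b u₁ v₁) (h₂ : IsTraj p lam a b u₂ v₂)
    (hu : u₁ a = u₂ a) (hv : v₁ a = v₂ a) (hE : energy p lam (u₁ a) (v₁ a) ≠ 0) :
    ∀ t ∈ Icc a b, u₁ t = u₂ t := by
  set s : Set ℝ := {t | t ∈ Icc a b ∧ u₁ t = u₂ t ∧ v₁ t = v₂ t} with hs
  have hclosed : IsClosed s := by
    have hcp := (h₁.cont_pos.prodMk h₁.cont_vel)
    have hcp2 := (h₂.cont_pos.prodMk h₂.cont_vel)
    have h := (hcp.prodMk hcp2).preimage_isClosed_of_isClosed isClosed_Icc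
      (isClosed_diagonal (X := ℝ × ℝ))
    convert h using 1
    ext t
    simp [hs]
  suffices hsub : Icc a b ⊆ s from fun t ht => (hsub ht).2.1
  rcases hab.eq_or_lt with rfl | hab
  · intro t ht
    obtain rfl : t = a := by simpa using ht
    exact ⟨ht, hu, hv⟩
  have hstep : ∀ x ∈ s ∩ Ico a b, ∃ c ∈ Ioc x b, ∀ t ∈ Icc x c, u₁ t = u₂ t := by
    rintro x ⟨⟨hx, hux, hvx⟩, hxb⟩
    by_cases hux0 : u₁ x = 0
    · refine (h₁.mono hx.1).eq_right_of_pos_eq_zero hp hxb.2 (h₂.mono hx.1) hux0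
        (hux ▸ hux0) hvx fun hvx0 => hE ?_
      rw [← h₁.energy_eq hp x hx, hux0, hvx0]
      simp [energy, Real.zero_rpow (by linarith : p ≠ 0)]
    · exact (h₁.mono hx.1).eq_right_of_pos_ne_zero hp hp2 hxb.2 (h₂.mono hx.1) hux hux0 hvx
  refine IsClosed.Icc_subset_of_forall_exists_gt (hclosed.inter isClosed_Icc)
    ⟨left_mem_Icc.2 hab.le, hu, hv⟩ fun x hx y hy => ?_
  obtain ⟨c, hc, hcs⟩ := hstep x hx
  obtain ⟨d, hd1, hd2⟩ := exists_between (lt_min hc.1 (mem_Ioi.1 hy))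
  have hdc := lt_min_iff.1 hd2
  have hda : a ≤ d := hx.2.1.trans hd1.le
  have hdb : d < b := hdc.1.trans_le hc.2
  refine ⟨d, ⟨⟨hda, hdb.le⟩, hcs d ⟨hd1.le, hdc.1.le⟩, ?_⟩, hd1, hdc.2.le⟩
  exact hasDerivWithinAt_Ici_unique hdc.1 (h₁.deriv_pos d ⟨hda, hdb⟩) (h₂.deriv_pos d ⟨hda, hdb⟩)
    fun t ht => hcs t ⟨hd1.le.trans ht.1, ht.2⟩

/-! ### Classical solutions as trajectories -/

theorem isSolP_zero (p q T lam : ℝ) : IsSolP p q T lam (fun _ => 0) := by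
  refine ⟨fun _ => 0, fun t _ => hasDerivWithinAt_const .., continuousOn_const, fun t _ => ?_,
    rfl, rfl⟩
  simpa [phi_zero] using hasDerivWithinAt_const (𝕜 := ℝ) t (Ioo 0 T) (phi p 0)

theorem IsSolP.neg {p q T lam : ℝ} {u : ℝ → ℝ} (h : IsSolP p q T lam u) :
    IsSolP p q T lam (fun t => -u t) := by
  obtain ⟨v, h1, h2, h3, h4, h5⟩ := h
  refine ⟨fun t => -v t, fun t ht => (h1 t ht).neg, h2.neg, fun t ht => ?_, by simp [h4],
    by simp [h5]⟩
  simp only [phi_neg, abs_neg]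
  exact (h3 t ht).neg.congr_deriv (by ring)

theorem isSolP_of_hasDerivAt {p T lam : ℝ} {u v : ℝ → ℝ} (hv : Continuous v)
    (hu' : ∀ t, HasDerivAt u (v t) t)
    (hv' : ∀ t, HasDerivAt (fun s => phi p (v s)) (-(lam * phi p (u t) * (1 - |u t| ^ p))) t)
    (h0 : u 0 = 0) (hT : u T = 0) : IsSolP p p T lam u :=
  ⟨v, fun t _ => (hu' t).hasDerivWithinAt, hv.continuousOn, fun t _ => (hv' t).hasDerivWithinAt,
    h0, hT⟩

theorem isTraj_of_hasDerivAt {p lam a b : ℝ} {u v : ℝ → ℝ} (hv : Continuous v)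
    (hu' : ∀ t, HasDerivAt u (v t) t)
    (hv' : ∀ t, HasDerivAt (fun s => phi p (v s)) (-(lam * phi p (u t) * (1 - |u t| ^ p))) t) :
    IsTraj p lam a b u v :=
  ⟨fun t _ => (hu' t).continuousAt.continuousWithinAt, hv.continuousOn,
    fun t _ => (hu' t).hasDerivWithinAt, fun t _ => (hv' t).hasDerivWithinAt⟩

theorem IsSolP.exists_isTraj {p T lam : ℝ} {u : ℝ → ℝ} (hp : 1 < p) (hT : 0 < T)
    (h : IsSolP p p T lam u) :
    ∃ v, IsTraj p lam 0 T u v ∧ (∀ t ∈ Ioo 0 T, HasDerivAt u (v t) t) ∧ u 0 = 0 ∧ u T = 0 := by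
  obtain ⟨v, h1, h2, h3, h4, h5⟩ := h
  have hcu : ContinuousOn u (Icc 0 T) := fun t ht => (h1 t ht).continuousWithinAt
  have hw : ∀ t ∈ Ioo 0 T, HasDerivAt (fun s => phi p (v s))
      (-(lam * phi p (u t) * (1 - |u t| ^ p))) t := fun t ht =>
    (h3 t ht).hasDerivAt (isOpen_Ioo.mem_nhds ht)
  refine ⟨v, ⟨hcu, h2, fun t ht => ?_, fun t ht => ?_⟩, fun t ht => ?_, h4, h5⟩
  · refine (h1 t ⟨ht.1, ht.2.le⟩).mono_of_mem_nhdsWithin ?_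
    exact mem_of_superset (Icc_mem_nhdsGE ht.2) (Icc_subset_Icc_left ht.1)
  · rcases ht.1.eq_or_lt with rfl | ht0
    · refine hasDerivWithinAt_Ici_of_tendsto_deriv (s := Ioo 0 T)
        (fun t ht => (hw t ht).differentiableAt.differentiableWithinAt) ?_
        (Ioo_mem_nhdsGT hT) ?_
      · exact ((continuous_phi hp).comp_continuousOn h2 0 ⟨le_rfl, hT.le⟩).mono
          Ioo_subset_Icc_self
      · have hc : ContinuousOn (fun t => -(lam * phi p (u t) * (1 - |u t| ^ p))) (Icc 0 T) :=
          ((continuousOn_const.mul ((continuous_phi hp).comp_continuousOn hcu)).mul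
            (continuousOn_const.sub
              ((continuous_abs_rpow (by linarith)).comp_continuousOn hcu))).neg
        have h6 := (hc 0 ⟨le_rfl, hT.le⟩).mono Ioo_subset_Icc_self
        rw [ContinuousWithinAt, nhdsWithin_Ioo_eq_nhdsGT hT] at h6
        refine h6.congr' ?_
        filter_upwards [Ioo_mem_nhdsGT hT] with t ht using (hw t ht).deriv.symm
    · exact (hw t ⟨ht0, ht.2⟩).hasDerivWithinAt
  · exact (h1 t ⟨ht.1.le, ht.2.le⟩).hasDerivAt (Icc_mem_nhds ht.1 ht.2)

/-! ### The elliptic integral -/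

/-- The integrand of `arcsnPQ p p k`, made even in `s`. -/
noncomputable def arcsnIntegrand (p k s : ℝ) : ℝ :=
  ((1 - |s| ^ p) * (1 - k ^ p * |s| ^ p)) ^ (-(1 / p))

theorem abs_rpow_lt_one {p s : ℝ} (hp : 1 < p) (hs : |s| < 1) : |s| ^ p < 1 :=
  Real.rpow_lt_one (abs_nonneg s) hs (by linarith)

theorem snPoly_pos {p k s : ℝ} (hp : 1 < p) (hk0 : 0 ≤ k) (hk1 : k < 1) (hs : |s| < 1) :
    0 < (1 - |s| ^ p) * (1 - k ^ p * |s| ^ p) := by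
  have h1 := abs_rpow_lt_one hp hs
  have h2 := Real.rpow_lt_one hk0 hk1 (by linarith : 0 < p)
  have h3 := Real.rpow_nonneg (abs_nonneg s) p
  have h4 := Real.rpow_nonneg hk0 p
  exact mul_pos (by linarith) (by nlinarith)

theorem arcsnIntegrand_pos {p k s : ℝ} (hp : 1 < p) (hk0 : 0 ≤ k) (hk1 : k < 1) (hs : |s| < 1) :
    0 < arcsnIntegrand p k s := Real.rpow_pos_of_pos (snPoly_pos hp hk0 hk1 hs) _

theorem arcsnPQ_eq {p k σ : ℝ} (hσ : 0 ≤ σ) :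
    arcsnPQ p p k σ = ∫ s in (0 : ℝ)..σ, arcsnIntegrand p k s := by
  refine intervalIntegral.integral_congr fun s hs => ?_
  rw [uIcc_of_le hσ] at hs
  simp only [arcsnIntegrand, abs_of_nonneg hs.1]

theorem continuous_snPoly {p : ℝ} (hp : 1 < p) (k : ℝ) :
    Continuous fun s : ℝ => (1 - |s| ^ p) * (1 - k ^ p * |s| ^ p) := by
  have := continuous_abs_rpow (m := p) (by linarith)
  fun_prop

theorem measurable_arcsnIntegrand {p : ℝ} (hp : 1 < p) (k : ℝ) :
    Measurable (arcsnIntegrand p k) :=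
  (continuous_snPoly hp k).measurable.pow_const _

theorem intervalIntegrable_one_sub_rpow {p : ℝ} (hp : 1 < p) (c : ℝ) :
    IntervalIntegrable (fun s : ℝ => c * (1 - s) ^ (-(1 / p))) volume 0 1 := by
  have h1 : -1 < -(1 / p) := by
    rw [neg_lt_neg_iff, div_lt_one (by linarith)]; exact hp
  have := (intervalIntegral.intervalIntegrable_rpow' (a := 1) (b := 0) h1).comp_sub_left 1
  simpa using this.const_mul c

theorem norm_arcsnIntegrand_le {p k r s : ℝ} (hp : 1 < p) (hk0 : 0 ≤ k) (hkr : k ≤ r) (hr : r < 1)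
    (hs : s ∈ Ioc (0 : ℝ) 1) :
    ‖arcsnIntegrand p k s‖ ≤ (1 - r ^ p) ^ (-(1 / p)) * (1 - s) ^ (-(1 / p)) := by
  have hp0 : 0 < p := by linarith
  have hneg : -(1 / p) < 0 := by rw [neg_lt_zero]; positivity
  have hrp := Real.rpow_lt_one (hk0.trans hkr) hr hp0
  rcases hs.2.eq_or_lt with rfl | hs1
  · simp only [arcsnIntegrand, abs_one, Real.one_rpow, sub_self, zero_mul,
      Real.zero_rpow hneg.ne, mul_zero, norm_zero, le_refl]
  have habs : |s| < 1 := by rwa [abs_of_pos hs.1]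
  rw [Real.norm_of_nonneg (arcsnIntegrand_pos hp hk0 (hkr.trans_lt hr) habs).le, arcsnIntegrand,
    ← Real.mul_rpow (x := 1 - r ^ p) (y := 1 - s) (by linarith) (by linarith)]
  refine Real.rpow_le_rpow_of_nonpos (mul_pos (by linarith) (by linarith)) ?_ hneg.le
  rw [abs_of_pos hs.1, mul_comm]
  have h1 : s ^ p ≤ s := by
    simpa using Real.rpow_le_rpow_of_exponent_ge hs.1 hs.2 hp.le
  have h2 : k ^ p ≤ r ^ p := Real.rpow_le_rpow hk0 hkr hp0.le
  have h3 := Real.rpow_nonneg hk0 p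
  have h4 := Real.rpow_nonneg hs.1.le p
  exact mul_le_mul (by linarith) (by nlinarith) (by linarith) (by linarith)

theorem intervalIntegrable_arcsnIntegrand {p k : ℝ} (hp : 1 < p) (hk0 : 0 ≤ k) (hk1 : k < 1) :
    IntervalIntegrable (arcsnIntegrand p k) volume 0 1 := by
  refine (intervalIntegrable_one_sub_rpow hp ((1 - k ^ p) ^ (-(1 / p)))).mono_fun
    (measurable_arcsnIntegrand hp k).aestronglyMeasurable ?_
  refine (ae_restrict_iff' measurableSet_uIoc).2 (Eventually.of_forall fun s hs => ?_)
  rw [uIoc_of_le zero_le_one] at hs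
  exact (norm_arcsnIntegrand_le hp hk0 le_rfl hk1 hs).trans (le_abs_self _)

theorem Kpq_eq (p k : ℝ) : Kpq p p k = ∫ s in (0 : ℝ)..1, arcsnIntegrand p k s :=
  arcsnPQ_eq zero_le_one

theorem piPQ_eq {p : ℝ} (hp : 1 < p) : piPQ p p = 2 * Kpq p p 0 := by
  simp [piPQ, arcsinPQ, Kpq, arcsnPQ, Real.zero_rpow (by linarith : p ≠ 0)]

theorem Kpq_pos {p k : ℝ} (hp : 1 < p) (hk0 : 0 ≤ k) (hk1 : k < 1) : 0 < Kpq p p k := by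
  rw [Kpq_eq]
  refine intervalIntegral.intervalIntegral_pos_of_pos_on
    (intervalIntegrable_arcsnIntegrand hp hk0 hk1) (fun s hs => ?_) one_pos
  exact arcsnIntegrand_pos hp hk0 hk1 (by rw [abs_of_pos hs.1]; exact hs.2)

theorem Kpq_mono {p k l : ℝ} (hp : 1 < p) (hk0 : 0 ≤ k) (hkl : k ≤ l) (hl : l < 1) :
    Kpq p p k ≤ Kpq p p l := by
  rw [Kpq_eq, Kpq_eq]
  refine intervalIntegral.integral_mono_on_of_le_Ioo zero_le_one
    (intervalIntegrable_arcsnIntegrand hp hk0 (hkl.trans_lt hl))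
    (intervalIntegrable_arcsnIntegrand hp (hk0.trans hkl) hl) fun s hs => ?_
  have hs' : |s| < 1 := by rw [abs_of_pos hs.1]; exact hs.2
  refine Real.rpow_le_rpow_of_nonpos (snPoly_pos hp (hk0.trans hkl) hl hs') ?_ ?_
  · have h1 := abs_rpow_lt_one hp hs'
    have h2 := Real.rpow_nonneg (abs_nonneg s) p
    gcongr
  · rw [neg_nonpos]; positivity

theorem continuousOn_Kpq {p : ℝ} (hp : 1 < p) : ContinuousOn (Kpq p p) (Ico 0 1) := by
  intro k hk
  obtain ⟨r, hkr, hr⟩ := exists_between hk.2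
  have hp0 : 0 < p := by linarith
  simp only [funext (Kpq_eq p)]
  have hev : ∀ᶠ x in 𝓝[Ico 0 1] k, 0 ≤ x ∧ x ≤ r := by
    filter_upwards [self_mem_nhdsWithin, mem_nhdsWithin_of_mem_nhds (Iio_mem_nhds hkr)]
      with x hx hxr using ⟨hx.1, (mem_Iio.1 hxr).le⟩
  refine intervalIntegral.continuousWithinAt_of_dominated_interval
    (bound := fun s => (1 - r ^ p) ^ (-(1 / p)) * (1 - s) ^ (-(1 / p)))
    (Eventually.of_forall fun x => (measurable_arcsnIntegrand hp x).aestronglyMeasurable) ?_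
    (intervalIntegrable_one_sub_rpow hp _) ?_
  · filter_upwards [hev] with x hx
    refine Eventually.of_forall fun s hs => ?_
    rw [uIoc_of_le zero_le_one] at hs
    exact norm_arcsnIntegrand_le hp hx.1 hx.2 hr hs
  · refine Eventually.of_forall fun s hs => ?_
    rw [uIoc_of_le zero_le_one] at hs
    rcases hs.2.eq_or_lt with rfl | hs1
    · simp only [arcsnIntegrand, abs_one, Real.one_rpow, sub_self, zero_mul]
      exact continuousWithinAt_const
    · have hs' : |s| < 1 := by rw [abs_of_pos hs.1]; exact hs1
      have hc : ContinuousAt (fun x : ℝ => (1 - |s| ^ p) * (1 - x ^ p * |s| ^ p)) k :=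
        continuousAt_const.mul (continuousAt_const.sub
          ((continuousAt_id.rpow_const (Or.inr hp0.le)).mul continuousAt_const))
      exact (hc.rpow_const (Or.inl (snPoly_pos hp hk.1 hk.2 hs').ne')).continuousWithinAt

theorem Kpq_lower_bound {p k : ℝ} (hp : 1 < p) (hp2 : p ≤ 2) (hk0 : 0 < k) (hk1 : k < 1) :
    -Real.log (1 - k) / p ≤ Kpq p p k := by
  have hp0 : 0 < p := by linarith
  have hne : ∀ s ∈ Icc (0 : ℝ) 1, 0 < 1 - k * s := fun s hs => by nlinarith [hs.1, hs.2]
  have hcont : ContinuousOn (fun s : ℝ => 1 / (p * (1 - k * s))) (uIcc 0 1) := by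
    rw [uIcc_of_le zero_le_one]
    refine ContinuousOn.div continuousOn_const (by fun_prop) fun s hs => ?_
    exact (mul_pos hp0 (hne s hs)).ne'
  have hval : ∫ s in (0 : ℝ)..1, 1 / (p * (1 - k * s)) = -Real.log (1 - k) / (p * k) := by
    have := intervalIntegral.integral_eq_sub_of_hasDerivAt
      (f := fun s => -Real.log (1 - k * s) / (p * k)) (f' := fun s => 1 / (p * (1 - k * s)))
      (a := 0) (b := 1) (fun s hs => ?_) hcont.intervalIntegrable
    · simpa using this
    · rw [uIcc_of_le zero_le_one] at hs
      have h1 : HasDerivAt (fun s : ℝ => 1 - k * s) (-k) s := by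
        simpa using ((hasDerivAt_id s).const_mul k).const_sub 1
      refine ((h1.log (hne s hs).ne').neg.div_const (p * k)).congr_deriv ?_
      have := (hne s hs).ne'
      field_simp
  have hlog : 0 ≤ -Real.log (1 - k) := by
    rw [neg_nonneg]; exact Real.log_nonpos (by linarith) (by linarith)
  calc -Real.log (1 - k) / p ≤ -Real.log (1 - k) / (p * k) :=
        div_le_div_of_nonneg_left hlog (mul_pos hp0 hk0) (by nlinarith)
    _ = ∫ s in (0 : ℝ)..1, 1 / (p * (1 - k * s)) := hval.symm
    _ ≤ Kpq p p k := ?_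
  rw [Kpq_eq]
  refine intervalIntegral.integral_mono_on_of_le_Ioo zero_le_one hcont.intervalIntegrable
    (intervalIntegrable_arcsnIntegrand hp hk0.le hk1) fun s hs => ?_
  have hs' : |s| < 1 := by rw [abs_of_pos hs.1]; exact hs.2
  have hks : k ^ p * |s| ^ p = (k * s) ^ p := by
    rw [abs_of_pos hs.1, Real.mul_rpow hk0.le hs.1.le]
  have hks0 : 0 < k * s := mul_pos hk0 hs.1
  have hks1 : k * s < 1 := by nlinarith [hs.1, hs.2]
  have hB : 1 - (k * s) ^ p ≤ p * (1 - k * s) := by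
    have := one_add_mul_self_le_rpow_one_add (s := k * s - 1) (by linarith) hp.le
    have h2 : 1 + (k * s - 1) = k * s := by ring
    rw [h2] at this
    linarith
  have hX0 : 0 < 1 - (k * s) ^ p := by
    linarith [Real.rpow_lt_one hks0.le hks1 hp0]
  have hX1 : 1 - (k * s) ^ p ≤ 1 := by linarith [Real.rpow_nonneg hks0.le p]
  have hle : (1 - |s| ^ p) * (1 - k ^ p * |s| ^ p) ≤ (1 - (k * s) ^ p) ^ (2 : ℝ) := by
    rw [hks, Real.rpow_two, sq]
    have : (k * s) ^ p ≤ |s| ^ p :=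
      Real.rpow_le_rpow hks0.le (by rw [abs_of_pos hs.1]; nlinarith [hs.1]) hp0.le
    exact mul_le_mul_of_nonneg_right (by linarith) hX0.le
  calc 1 / (p * (1 - k * s)) ≤ 1 / (1 - (k * s) ^ p) := one_div_le_one_div_of_le hX0 hB
    _ = (1 - (k * s) ^ p) ^ (-1 : ℝ) := by rw [Real.rpow_neg_one, one_div]
    _ ≤ (1 - (k * s) ^ p) ^ (2 * -(1 / p)) := by
        refine Real.rpow_le_rpow_of_exponent_ge hX0 hX1 ?_
        have : 1 ≤ 2 / p := by rw [le_div_iff₀ hp0]; linarith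
        have h3 : 2 * -(1 / p) = -(2 / p) := by ring
        linarith
    _ = ((1 - (k * s) ^ p) ^ (2 : ℝ)) ^ (-(1 / p)) := Real.rpow_mul hX0.le _ _
    _ ≤ arcsnIntegrand p k s :=
        Real.rpow_le_rpow_of_nonpos (snPoly_pos hp hk0.le hk1 hs') hle
          (by rw [neg_nonpos]; positivity)

/-! ### The symmetric incomplete elliptic integral -/

/-- The odd extension of `arcsnPQ p p k` to `[-1, 1]`. -/
noncomputable def arcsnOdd (p k σ : ℝ) : ℝ := ∫ s in (0 : ℝ)..σ, arcsnIntegrand p k s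

theorem arcsnIntegrand_neg (p k s : ℝ) : arcsnIntegrand p k (-s) = arcsnIntegrand p k s := by
  simp [arcsnIntegrand]

theorem arcsnOdd_neg (p k σ : ℝ) : arcsnOdd p k (-σ) = -arcsnOdd p k σ := by
  have h := intervalIntegral.integral_comp_neg (a := 0) (b := σ) (arcsnIntegrand p k)
  simp only [arcsnIntegrand_neg, neg_zero] at h
  rw [arcsnOdd, arcsnOdd, h, ← intervalIntegral.integral_symm]

theorem arcsnOdd_one (p k : ℝ) : arcsnOdd p k 1 = Kpq p p k := (Kpq_eq p k).symm

section arcsnOdd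

variable {p k : ℝ} (hp : 1 < p) (hk0 : 0 ≤ k) (hk1 : k < 1)
include hp hk0 hk1

theorem intervalIntegrable_arcsnIntegrand_symm :
    IntervalIntegrable (arcsnIntegrand p k) volume (-1) 1 := by
  have h := intervalIntegrable_arcsnIntegrand hp hk0 hk1
  have h2 := (IntervalIntegrable.iff_comp_neg (f := arcsnIntegrand p k) (a := 0) (b := 1)).1 h
  simp only [arcsnIntegrand_neg, neg_zero] at h2
  exact h2.symm.trans h

theorem continuousOn_arcsnOdd : ContinuousOn (arcsnOdd p k) (Icc (-1) 1) := by
  have := intervalIntegral.continuousOn_primitive_interval'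
    (intervalIntegrable_arcsnIntegrand_symm hp hk0 hk1) (a := 0) (by simp [uIcc_of_le])
  rwa [uIcc_of_le (by norm_num)] at this

theorem hasDerivAt_arcsnOdd {σ : ℝ} (hσ : |σ| < 1) :
    HasDerivAt (arcsnOdd p k) (arcsnIntegrand p k σ) σ := by
  have hσ' := abs_lt.1 hσ
  refine intervalIntegral.integral_hasDerivAt_right ?_
    (measurable_arcsnIntegrand hp k).stronglyMeasurable.stronglyMeasurableAtFilter ?_
  · refine (intervalIntegrable_arcsnIntegrand_symm hp hk0 hk1).mono_set ?_
    rw [uIcc_of_le (by norm_num : (-1 : ℝ) ≤ 1)]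
    exact uIcc_subset_Icc (by norm_num) ⟨hσ'.1.le, hσ'.2.le⟩
  · exact (continuous_snPoly hp k).continuousAt.rpow_const
      (Or.inl (snPoly_pos hp hk0 hk1 hσ).ne')

theorem strictMonoOn_arcsnOdd : StrictMonoOn (arcsnOdd p k) (Icc (-1) 1) := by
  refine strictMonoOn_of_deriv_pos (convex_Icc _ _) (continuousOn_arcsnOdd hp hk0 hk1) ?_
  intro σ hσ
  rw [interior_Icc] at hσ
  have hσ' : |σ| < 1 := abs_lt.2 hσ
  rw [(hasDerivAt_arcsnOdd hp hk0 hk1 hσ').deriv]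
  exact arcsnIntegrand_pos hp hk0 hk1 hσ'

theorem exists_arcsnOdd_eq {t : ℝ} (ht : t ∈ Icc (-Kpq p p k) (Kpq p p k)) :
    ∃ σ ∈ Icc (-1 : ℝ) 1, arcsnOdd p k σ = t := by
  have h := intermediate_value_Icc (by norm_num) (continuousOn_arcsnOdd hp hk0 hk1)
  rw [arcsnOdd_neg, arcsnOdd_one] at h
  exact h ht

end arcsnOdd

/-! ### The generalized Jacobi function -/

/-- `S` is the function `sn_{pp}(·, k)`. -/
structure IsSn (p k : ℝ) (S : ℝ → ℝ) : Prop where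
  inv : ∀ σ ∈ Icc (0 : ℝ) 1, S (arcsnPQ p p k σ) = σ
  refl : ∀ t ∈ Icc (Kpq p p k) (2 * Kpq p p k), S t = S (2 * Kpq p p k - t)
  odd : ∀ t, S (-t) = -S t
  per : ∀ t, S (t + 4 * Kpq p p k) = S t

/-- A removable-singularity criterion for differentiability. -/
theorem hasDerivAt_of_tendsto_punctured {f g : ℝ → ℝ} {x L : ℝ}
    (hd : ∀ᶠ y in 𝓝[≠] x, HasDerivAt f (g y) y) (hf : ContinuousAt f x)
    (hg : Tendsto g (𝓝[≠] x) (𝓝 L)) : HasDerivAt f L x := by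
  have hlim : Tendsto (deriv f) (𝓝[≠] x) (𝓝 L) :=
    hg.congr' (hd.mono fun y hy => hy.deriv.symm)
  have hlt : 𝓝[<] x ≤ 𝓝[≠] x := nhdsWithin_mono _ fun y hy => ne_of_lt hy
  have hgt : 𝓝[>] x ≤ 𝓝[≠] x := nhdsWithin_mono _ fun y hy => ne_of_gt hy
  have hdiff : DifferentiableOn ℝ f {y | DifferentiableAt ℝ f y} :=
    fun y hy => DifferentiableAt.differentiableWithinAt hy
  have hmem : ∀ᶠ y in 𝓝[≠] x, DifferentiableAt ℝ f y := hd.mono fun y hy => hy.differentiableAt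
  have h1 : HasDerivWithinAt f L (Ici x) x := hasDerivWithinAt_Ici_of_tendsto_deriv hdiff
    hf.continuousWithinAt (hgt hmem) (hlim.mono_left hgt)
  have h2 : HasDerivWithinAt f L (Iic x) x := hasDerivWithinAt_Iic_of_tendsto_deriv hdiff
    hf.continuousWithinAt (hlt hmem) (hlim.mono_left hlt)
  simpa [Iic_union_Ici] using h2.union h1

/-- The right-hand side of the equation satisfied by `sn_{pp}(·, k)`. -/
noncomputable def snForce (p k x : ℝ) : ℝ :=
  -((p - 1) * phi p x * (1 + k ^ p - 2 * k ^ p * |x| ^ p))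

theorem snForce_neg (p k x : ℝ) : snForce p k (-x) = -snForce p k x := by
  simp [snForce, phi_neg]

theorem continuous_snForce {p : ℝ} (hp : 1 < p) (k : ℝ) : Continuous (snForce p k) := by
  have h1 := continuous_phi hp
  have h2 := continuous_abs_rpow (m := p) (by linarith)
  unfold snForce
  fun_prop

theorem hasDerivAt_snPoly {p : ℝ} (hp : 1 < p) (k x : ℝ) :
    HasDerivAt (fun s : ℝ => (1 - |s| ^ p) * (1 - k ^ p * |s| ^ p))
      (p / (p - 1) * snForce p k x) x := by
  have h := hasDerivAt_abs_rpow_phi hp x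
  refine ((h.const_sub 1).mul ((h.const_mul (k ^ p)).const_sub 1)).congr_deriv ?_
  have : p - 1 ≠ 0 := by linarith
  rw [snForce]
  field_simp
  ring

namespace IsSn

variable {p k : ℝ} {S : ℝ → ℝ}

theorem antiperiodic (h : IsSn p k S) (hK : 0 < Kpq p p k) :
    Function.Antiperiodic S (2 * Kpq p p k) := by
  set K := Kpq p p k with hKdef
  have hA : ∀ t ∈ Icc (-K) K, S (t + 2 * K) = -S t := by
    intro t ht
    rcases le_total t 0 with ht0 | ht0
    · rw [h.refl (t + 2 * K) ⟨by linarith [ht.1], by linarith⟩, ← h.odd]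
      congr 1; ring
    · have h4 : S (t + 2 * K) = S (t + 2 * K - 4 * K) := by
        simpa [← hKdef] using h.per (t + 2 * K - 4 * K)
      rw [h4, show t + 2 * K - 4 * K = -(2 * K - t) by ring, h.odd,
        h.refl (2 * K - t) ⟨by linarith [ht.2], by linarith⟩, sub_sub_cancel]
  have hper : Function.Periodic S (4 * K) := h.per
  intro t
  obtain ⟨n, hn, -⟩ := existsUnique_sub_zsmul_mem_Ioc (by linarith : 0 < 4 * K) t (-K)
  have e1 : S t = S (t - n • (4 * K)) := (hper.sub_zsmul_eq n).symm
  have e2 : S (t + 2 * K) = S (t - n • (4 * K) + 2 * K) := by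
    rw [← hper.sub_zsmul_eq n (x := t + 2 * K)]; congr 1; ring
  rw [e1, e2]
  set s := t - n • (4 * K)
  rcases le_total s K with hs | hs
  · exact hA s ⟨hn.1.le, hs⟩
  · have h1 := hA (s - 2 * K) ⟨by linarith, by linarith [hn.2]⟩
    rw [sub_add_cancel] at h1
    rw [h1, neg_neg, ← h.per (s - 2 * K)]
    congr 1; ring

theorem apply_arcsnOdd (h : IsSn p k S) {σ : ℝ} (hσ : σ ∈ Icc (-1 : ℝ) 1) :
    S (arcsnOdd p k σ) = σ := by
  have key : ∀ σ ∈ Icc (0 : ℝ) 1, S (arcsnOdd p k σ) = σ := fun σ hσ => by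
    rw [arcsnOdd, ← arcsnPQ_eq hσ.1]; exact h.inv σ hσ
  rcases le_total 0 σ with h0 | h0
  · exact key σ ⟨h0, hσ.2⟩
  · have := key (-σ) ⟨by linarith, by linarith [hσ.1]⟩
    rw [arcsnOdd_neg, h.odd] at this
    linarith

theorem apply_zero (h : IsSn p k S) : S 0 = 0 := by
  have := h.odd 0
  rw [neg_zero] at this
  linarith

theorem apply_K (h : IsSn p k S) : S (Kpq p p k) = 1 := by
  rw [← arcsnOdd_one]; exact h.apply_arcsnOdd (by simp)

section

variable (h : IsSn p k S) (hp : 1 < p) (hk0 : 0 ≤ k) (hk1 : k < 1)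
include h hp hk0 hk1

theorem strictMonoOn : StrictMonoOn S (Icc (-Kpq p p k) (Kpq p p k)) := by
  intro t ht s hs hts
  obtain ⟨σ, hσ, rfl⟩ := exists_arcsnOdd_eq hp hk0 hk1 ht
  obtain ⟨τ, hτ, rfl⟩ := exists_arcsnOdd_eq hp hk0 hk1 hs
  rw [h.apply_arcsnOdd hσ, h.apply_arcsnOdd hτ]
  exact ((strictMonoOn_arcsnOdd hp hk0 hk1).lt_iff_lt hσ hτ).1 hts

theorem Icc_subset_image : Icc (-1) 1 ⊆ S '' Icc (-Kpq p p k) (Kpq p p k) := by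
  intro σ hσ
  have hm := (strictMonoOn_arcsnOdd hp hk0 hk1).monotoneOn
  refine ⟨arcsnOdd p k σ, ⟨?_, ?_⟩, h.apply_arcsnOdd hσ⟩
  · have := hm (left_mem_Icc.2 (by norm_num)) hσ hσ.1
    rwa [arcsnOdd_neg, arcsnOdd_one] at this
  · have := hm hσ (right_mem_Icc.2 (by norm_num)) hσ.2
    rwa [arcsnOdd_one] at this

theorem abs_lt_one {t : ℝ} (ht : t ∈ Ioo (-Kpq p p k) (Kpq p p k)) : |S t| < 1 := by
  have hK := Kpq_pos hp hk0 hk1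
  have hm := h.strictMonoOn hp hk0 hk1
  have h1 := hm (left_mem_Icc.2 (by linarith)) (Ioo_subset_Icc_self ht) ht.1
  have h2 := hm (Ioo_subset_Icc_self ht) (right_mem_Icc.2 (by linarith)) ht.2
  rw [h.odd, h.apply_K] at h1
  rw [h.apply_K] at h2
  exact abs_lt.2 ⟨h1, h2⟩

theorem continuousAt_of_mem {t : ℝ} (ht : t ∈ Ioo (-Kpq p p k) (Kpq p p k)) :
    ContinuousAt S t := by
  have habs := abs_lt.1 (h.abs_lt_one hp hk0 hk1 ht)
  exact (h.strictMonoOn hp hk0 hk1).continuousAt_of_image_mem_nhds (Icc_mem_nhds ht.1 ht.2)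
    (mem_of_superset (Icc_mem_nhds habs.1 habs.2) (h.Icc_subset_image hp hk0 hk1))

theorem continuousAt_K : ContinuousAt S (Kpq p p k) := by
  have hK := Kpq_pos hp hk0 hk1
  have hleft : ContinuousWithinAt S (Iic (Kpq p p k)) (Kpq p p k) := by
    refine (h.strictMonoOn hp hk0 hk1).continuousWithinAt_left_of_image_mem_nhdsWithin
      (Icc_mem_nhdsLE (by linarith)) ?_
    rw [h.apply_K]
    exact mem_of_superset (Icc_mem_nhdsLE (by norm_num)) (h.Icc_subset_image hp hk0 hk1)
  refine continuousAt_iff_continuous_left_right.2 ⟨hleft, ?_⟩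
  have hrefl : ∀ t, S t = S (2 * Kpq p p k - t) := fun t => by
    have := h.antiperiodic hK (-t)
    rw [h.odd, neg_neg] at this
    rw [← this]; congr 1; ring
  have hc : ContinuousWithinAt (fun t => S (2 * Kpq p p k - t)) (Ici (Kpq p p k))
      (Kpq p p k) := by
    refine ContinuousWithinAt.comp (t := Iic (Kpq p p k)) ?_
      (continuous_const.sub continuous_id).continuousWithinAt fun t ht => ?_
    · simpa [two_mul] using hleft
    · simp only [mem_Ici] at ht
      simp only [mem_Iic]
      linarith
  exact hc.congr (fun t _ => hrefl t) (hrefl _)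

theorem hasDerivAt_of_mem {t : ℝ} (ht : t ∈ Ioo (-Kpq p p k) (Kpq p p k)) :
    HasDerivAt S (((1 - |S t| ^ p) * (1 - k ^ p * |S t| ^ p)) ^ (1 / p)) t := by
  have habs := h.abs_lt_one hp hk0 hk1 ht
  have hpos := snPoly_pos hp hk0 hk1 habs
  have hd := HasDerivAt.of_local_left_inverse (h.continuousAt_of_mem hp hk0 hk1 ht)
    (hasDerivAt_arcsnOdd hp hk0 hk1 habs) (arcsnIntegrand_pos hp hk0 hk1 habs).ne' ?_
  · rwa [arcsnIntegrand, Real.rpow_neg hpos.le, inv_inv] at hd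
  · filter_upwards [Ioo_mem_nhds ht.1 ht.2] with s hs
    obtain ⟨σ, hσ, rfl⟩ := exists_arcsnOdd_eq hp hk0 hk1 (Ioo_subset_Icc_self hs)
    rw [h.apply_arcsnOdd hσ]

theorem hasDerivAt_phi_deriv_of_mem {t : ℝ} (ht : t ∈ Ioo (-Kpq p p k) (Kpq p p k)) :
    HasDerivAt (fun s => phi p (deriv S s)) (snForce p k (S t)) t := by
  have hp0 : p ≠ 0 := by linarith
  have hpos := snPoly_pos hp hk0 hk1 (h.abs_lt_one hp hk0 hk1 ht)
  have hd := ((hasDerivAt_snPoly hp k (S t)).comp t (h.hasDerivAt_of_mem hp hk0 hk1 ht)).rpow_const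
    (p := (p - 1) / p) (Or.inl hpos.ne')
  refine (hd.congr_deriv ?_).congr_of_eventuallyEq ?_
  · simp only [Function.comp]
    set W := (1 - |S t| ^ p) * (1 - k ^ p * |S t| ^ p)
    have hW : W ^ (1 / p) * W ^ ((p - 1) / p - 1) = 1 := by
      rw [← Real.rpow_add hpos, show 1 / p + ((p - 1) / p - 1) = 0 by field_simp; ring,
        Real.rpow_zero]
    have hp1 : p - 1 ≠ 0 := by linarith
    calc p / (p - 1) * snForce p k (S t) * W ^ (1 / p) * ((p - 1) / p) * W ^ ((p - 1) / p - 1)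
        = p / (p - 1) * ((p - 1) / p) * snForce p k (S t)
          * (W ^ (1 / p) * W ^ ((p - 1) / p - 1)) := by ring
      _ = snForce p k (S t) := by rw [hW]; field_simp
  · filter_upwards [Ioo_mem_nhds ht.1 ht.2] with s hs
    have hpos := snPoly_pos hp hk0 hk1 (h.abs_lt_one hp hk0 hk1 hs)
    rw [(h.hasDerivAt_of_mem hp hk0 hk1 hs).deriv, phi_of_pos (Real.rpow_pos_of_pos hpos _),
      ← Real.rpow_mul hpos.le]
    simp only [Function.comp]
    congr 1
    field_simp

end

/-- `sn_{pp}(·, k)` solves its differential equation at `t`. -/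
def SolvesAt (p k : ℝ) (S : ℝ → ℝ) (t : ℝ) : Prop :=
  HasDerivAt S (deriv S t) t ∧ HasDerivAt (fun s => phi p (deriv S s)) (snForce p k (S t)) t

theorem deriv_antiperiodic {c : ℝ} (hS : Function.Antiperiodic S c) :
    Function.Antiperiodic (deriv S) c := by
  intro t
  rw [← deriv_comp_add_const, funext hS, deriv.fun_neg]

theorem solvesAt_of_add {c t : ℝ} (hS : Function.Antiperiodic S c)
    (ht : SolvesAt p k S (t + c)) : SolvesAt p k S t := by
  have hV := deriv_antiperiodic hS
  have h1 := (ht.1.comp_add_const t c).neg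
  have h2 := (ht.2.comp_add_const t c).neg
  refine ⟨?_, ?_⟩
  · rw [hV, neg_neg] at h1
    exact h1.congr_of_eventuallyEq (Eventually.of_forall fun s => by simp [hS s])
  · rw [hS, snForce_neg, neg_neg] at h2
    exact h2.congr_of_eventuallyEq (Eventually.of_forall fun s => by simp [hV s, phi_neg])

theorem solvesAt_periodic {c : ℝ} (hS : Function.Antiperiodic S c) :
    Function.Periodic (SolvesAt p k S) c := by
  intro t
  refine propext ⟨solvesAt_of_add hS, fun ht => ?_⟩
  refine solvesAt_of_add (c := -c) (fun s => ?_) (by simpa using ht)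
  have := hS (s + -c)
  rw [neg_add_cancel_right] at this
  rw [this, neg_neg]

section

variable (h : IsSn p k S) (hp : 1 < p) (hk0 : 0 ≤ k) (hk1 : k < 1)
include h hp hk0 hk1

theorem solvesAt_of_mem {t : ℝ} (ht : t ∈ Ioo (-Kpq p p k) (Kpq p p k)) : SolvesAt p k S t :=
  ⟨(h.hasDerivAt_of_mem hp hk0 hk1 ht).differentiableAt.hasDerivAt,
    h.hasDerivAt_phi_deriv_of_mem hp hk0 hk1 ht⟩

theorem solvesAt_K : SolvesAt p k S (Kpq p p k) := by
  have hK := Kpq_pos hp hk0 hk1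
  have hanti := h.antiperiodic hK
  have hV := deriv_antiperiodic hanti
  have hSc := h.continuousAt_K hp hk0 hk1
  have hp0 : p ≠ 0 := by linarith
  have hnear : ∀ᶠ t in 𝓝[≠] Kpq p p k, t ∈ Ioo (-Kpq p p k) (Kpq p p k) ∨
      t - 2 * Kpq p p k ∈ Ioo (-Kpq p p k) (Kpq p p k) := by
    filter_upwards [self_mem_nhdsWithin, mem_nhdsWithin_of_mem_nhds
      (Ioo_mem_nhds (show -Kpq p p k < Kpq p p k by linarith)
        (show Kpq p p k < 3 * Kpq p p k by linarith))] with t hne ht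
    rcases lt_or_gt_of_ne hne with hlt | hgt
    · exact Or.inl ⟨ht.1, hlt⟩
    · exact Or.inr ⟨by linarith, by linarith [ht.2]⟩
  have hsolve : ∀ᶠ t in 𝓝[≠] Kpq p p k, SolvesAt p k S t := by
    filter_upwards [hnear] with t ht
    rcases ht with ht | ht
    · exact h.solvesAt_of_mem hp hk0 hk1 ht
    · exact (solvesAt_periodic hanti).sub_eq t ▸ h.solvesAt_of_mem hp hk0 hk1 ht
  have habs : ∀ᶠ t in 𝓝[≠] Kpq p p k,
      ((1 - |S t| ^ p) * (1 - k ^ p * |S t| ^ p)) ^ (1 / p) = |deriv S t| := by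
    have key : ∀ t ∈ Ioo (-Kpq p p k) (Kpq p p k),
        ((1 - |S t| ^ p) * (1 - k ^ p * |S t| ^ p)) ^ (1 / p) = |deriv S t| := fun t ht => by
      rw [(h.hasDerivAt_of_mem hp hk0 hk1 ht).deriv]
      exact (abs_of_nonneg
        (Real.rpow_nonneg (snPoly_pos hp hk0 hk1 (h.abs_lt_one hp hk0 hk1 ht)).le _)).symm
    filter_upwards [hnear] with t ht
    rcases ht with ht | ht
    · exact key t ht
    · have := key _ ht
      rwa [hanti.sub_eq, hV.sub_eq, abs_neg, abs_neg] at this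
  have hVlim : Tendsto (deriv S) (𝓝[≠] Kpq p p k) (𝓝 0) := by
    rw [tendsto_zero_iff_abs_tendsto_zero]
    have hc : ContinuousAt (fun t => ((1 - |S t| ^ p) * (1 - k ^ p * |S t| ^ p)) ^ (1 / p))
        (Kpq p p k) :=
      ContinuousAt.rpow_const
        (ContinuousAt.comp (g := fun s : ℝ => (1 - |s| ^ p) * (1 - k ^ p * |s| ^ p))
          (continuous_snPoly hp k).continuousAt hSc)
        (Or.inr (by positivity))
    have hc' := hc.tendsto.mono_left (nhdsWithin_le_nhds (s := {Kpq p p k}ᶜ))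
    simp only [h.apply_K, abs_one, Real.one_rpow, sub_self, zero_mul] at hc'
    rw [Real.zero_rpow (one_div_ne_zero hp0)] at hc'
    exact hc'.congr' habs
  have hd : HasDerivAt S 0 (Kpq p p k) :=
    hasDerivAt_of_tendsto_punctured (hsolve.mono fun t ht => ht.1) hSc hVlim
  have hVc : ContinuousAt (deriv S) (Kpq p p k) := by
    rw [← continuousWithinAt_compl_self, ContinuousWithinAt, hd.deriv]
    exact hVlim
  refine ⟨hd.deriv.symm ▸ hd, hasDerivAt_of_tendsto_punctured (hsolve.mono fun t ht => ht.2)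
    ((continuous_phi hp).continuousAt.comp hVc) ?_⟩
  exact (((continuous_snForce hp k).continuousAt.comp hSc).tendsto).mono_left nhdsWithin_le_nhds

theorem solvesAt (t : ℝ) : SolvesAt p k S t := by
  have hK := Kpq_pos hp hk0 hk1
  obtain ⟨n, hn, -⟩ :=
    existsUnique_sub_zsmul_mem_Ioc (by linarith : 0 < 2 * Kpq p p k) t (-Kpq p p k)
  rw [← (solvesAt_periodic (h.antiperiodic hK)).sub_zsmul_eq n]
  rcases hn.2.eq_or_lt with he | hlt
  · rw [he, show -Kpq p p k + 2 * Kpq p p k = Kpq p p k by ring]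
    exact h.solvesAt_K hp hk0 hk1
  · exact h.solvesAt_of_mem hp hk0 hk1 ⟨hn.1, by linarith⟩

theorem continuous_deriv : Continuous (deriv S) := by
  have hq : 1 < p / (p - 1) := by rw [lt_div_iff₀ (by linarith)]; linarith
  have h1 : Continuous fun s => phi p (deriv S s) :=
    continuous_iff_continuousAt.2 fun t => (h.solvesAt hp hk0 hk1 t).2.continuousAt
  exact ((continuous_phi hq).comp h1).congr fun s => phi_conj_phi hp _

theorem deriv_zero : deriv S 0 = 1 := by
  have hK := Kpq_pos hp hk0 hk1
  rw [(h.hasDerivAt_of_mem hp hk0 hk1 ⟨by linarith, hK⟩).deriv, h.apply_zero]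
  simp [Real.zero_rpow (by linarith : p ≠ 0)]

theorem exists_int_of_eq_zero {t : ℝ} (ht : S t = 0) : ∃ n : ℤ, t = n * (2 * Kpq p p k) := by
  have hK := Kpq_pos hp hk0 hk1
  have hper : Function.Periodic (fun t => S t = 0) (2 * Kpq p p k) := fun t => by
    simp [h.antiperiodic hK t]
  obtain ⟨n, hn, -⟩ :=
    existsUnique_sub_zsmul_mem_Ioc (by linarith : 0 < 2 * Kpq p p k) t (-Kpq p p k)
  have h0 : S (t - n • (2 * Kpq p p k)) = 0 := (hper.sub_zsmul_eq n).symm ▸ ht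
  have := (h.strictMonoOn hp hk0 hk1).injOn ⟨hn.1.le, by linarith [hn.2]⟩
    (⟨by linarith, hK.le⟩ : (0 : ℝ) ∈ Icc (-Kpq p p k) (Kpq p p k)) (h0.trans h.apply_zero.symm)
  refine ⟨n, ?_⟩
  rw [zsmul_eq_mul] at this
  linarith

theorem apply_nat_mul (n : ℕ) : S (n * (2 * Kpq p p k)) = 0 := by
  have hper : Function.Periodic (fun t => S t = 0) (2 * Kpq p p k) := fun t => by
    simp [h.antiperiodic (Kpq_pos hp hk0 hk1) t]
  have := hper.nat_mul_eq n
  simp only [h.apply_zero, eq_iff_iff, iff_true] at this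
  exact this

end

end IsSn

/-- The amplitude of the solution with modulus `k`. -/
noncomputable def amplitude (p k : ℝ) : ℝ := (2 * k ^ p / (1 + k ^ p)) ^ (1 / p)

/-- The parameter `λ` for which the solution with modulus `k` has `j` half-waves on `(0,T)`. -/
noncomputable def modeParam (p T : ℝ) (j : ℕ) (k : ℝ) : ℝ :=
  (p - 1) * (1 + k ^ p) * (2 * j * Kpq p p k / T) ^ p

theorem amplitude_pos {p k : ℝ} (hk : 0 < k) : 0 < amplitude p k := by
  have := Real.rpow_pos_of_pos hk p
  unfold amplitude
  positivity

theorem amplitude_rpow {p k : ℝ} (hp : 1 < p) (hk : 0 < k) :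
    amplitude p k ^ p = 2 * k ^ p / (1 + k ^ p) := by
  have := Real.rpow_pos_of_pos hk p
  rw [amplitude, ← Real.rpow_mul (by positivity), one_div_mul_cancel (by linarith), Real.rpow_one]

namespace IsSn

variable {p k : ℝ} {S : ℝ → ℝ}

section

variable (h : IsSn p k S) (hp : 1 < p) (hk0 : 0 < k) (hk1 : k < 1)
include h hp hk0 hk1

theorem continuous_scaled_velocity (ω : ℝ) :
    Continuous fun t => amplitude p k * ω * deriv S (ω * t) := by
  have := h.continuous_deriv hp hk0.le hk1
  fun_prop

theorem hasDerivAt_scaled (ω t : ℝ) :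
    HasDerivAt (fun t => amplitude p k * S (ω * t)) (amplitude p k * ω * deriv S (ω * t)) t := by
  have h1 := (h.solvesAt hp hk0.le hk1 (ω * t)).1
  have h2 := (h1.comp t ((hasDerivAt_id t).const_mul ω)).const_mul (amplitude p k)
  exact h2.congr_deriv (by ring)

theorem hasDerivAt_phi_scaled_velocity {ω : ℝ} (hω : 0 < ω) (t : ℝ) :
    HasDerivAt (fun t => phi p (amplitude p k * ω * deriv S (ω * t)))
      (-((p - 1) * (1 + k ^ p) * ω ^ p * phi p (amplitude p k * S (ω * t)) *
        (1 - |amplitude p k * S (ω * t)| ^ p))) t := by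
  have ha := amplitude_pos (p := p) hk0
  have hkp := Real.rpow_pos_of_pos hk0 p
  have h1 := (h.solvesAt hp hk0.le hk1 (ω * t)).2
  have h2 := (h1.comp t ((hasDerivAt_id t).const_mul ω)).const_mul ((amplitude p k * ω) ^ (p - 1))
  have e : (fun t => phi p (amplitude p k * ω * deriv S (ω * t))) = fun t =>
      (amplitude p k * ω) ^ (p - 1) * phi p (deriv S (ω * t)) :=
    funext fun t => phi_mul_of_pos (mul_pos ha hω) _
  rw [e]
  refine h2.congr_deriv ?_
  have hωp : ω ^ p = ω ^ (p - 1) * ω := by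
    rw [← Real.rpow_add_one hω.ne', sub_add_cancel]
  rw [phi_mul_of_pos ha, abs_mul, abs_of_pos ha, Real.mul_rpow ha.le (abs_nonneg _),
    amplitude_rpow hp hk0, Real.mul_rpow ha.le hω.le, hωp, snForce]
  field_simp

theorem isTraj_scaled {ω : ℝ} (hω : 0 < ω) (a b : ℝ) :
    IsTraj p ((p - 1) * (1 + k ^ p) * ω ^ p) a b (fun t => amplitude p k * S (ω * t))
      (fun t => amplitude p k * ω * deriv S (ω * t)) :=
  isTraj_of_hasDerivAt (h.continuous_scaled_velocity hp hk0 hk1 ω)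
    (h.hasDerivAt_scaled hp hk0 hk1 ω) (h.hasDerivAt_phi_scaled_velocity hp hk0 hk1 hω)

theorem isSolP_mode {T : ℝ} (hT : 0 < T) {j : ℕ} (hj : 1 ≤ j) :
    IsSolP p p T (modeParam p T j k)
      (fun t => amplitude p k * S (2 * j * Kpq p p k / T * t)) := by
  have hK := Kpq_pos hp hk0.le hk1
  have hj' : (0 : ℝ) < j := by exact_mod_cast hj
  refine isSolP_of_hasDerivAt (h.continuous_scaled_velocity hp hk0 hk1 _)
    (h.hasDerivAt_scaled hp hk0 hk1 _)
    (h.hasDerivAt_phi_scaled_velocity hp hk0 hk1 (by positivity)) ?_ ?_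
  · rw [mul_zero, h.apply_zero, mul_zero]
  · rw [div_mul_cancel₀ _ hT.ne', show 2 * (j : ℝ) * Kpq p p k = j * (2 * Kpq p p k) by ring,
      h.apply_nat_mul hp hk0.le hk1, mul_zero]

end

end IsSn

theorem modeParam_lt_of_lt {p T k l : ℝ} {j : ℕ} (hp : 1 < p) (hT : 0 < T) (hj : 1 ≤ j)
    (hk0 : 0 ≤ k) (hkl : k < l) (hl : l < 1) : modeParam p T j k < modeParam p T j l := by
  have hj' : (0 : ℝ) < j := by exact_mod_cast hj
  have hK := Kpq_pos hp hk0 (hkl.trans hl)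
  have hKl := Kpq_mono hp hk0 hkl.le hl
  have h1 : k ^ p < l ^ p := Real.rpow_lt_rpow hk0 hkl (by linarith)
  have h2 : (2 * j * Kpq p p k / T) ^ p ≤ (2 * j * Kpq p p l / T) ^ p := by
    refine Real.rpow_le_rpow (by positivity) ?_ (by linarith)
    gcongr
  have h3 : 0 < (2 * j * Kpq p p k / T) ^ p := by positivity
  have h4 : 0 ≤ k ^ p := Real.rpow_nonneg hk0 _
  have h5 : 0 < p - 1 := by linarith
  unfold modeParam
  exact mul_lt_mul (by nlinarith) h2 h3 (by nlinarith)

theorem modeParam_lt_of_mode_lt {p T k : ℝ} {i j : ℕ} (hp : 1 < p) (hT : 0 < T) (hij : i < j)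
    (hk0 : 0 ≤ k) (hk1 : k < 1) : modeParam p T i k < modeParam p T j k := by
  have hK := Kpq_pos hp hk0 hk1
  have h4 : 0 ≤ k ^ p := Real.rpow_nonneg hk0 _
  have h5 : 0 < p - 1 := by linarith
  have hij' : (i : ℝ) < j := by exact_mod_cast hij
  unfold modeParam
  gcongr

theorem modeParam_zero {p T : ℝ} (hp : 1 < p) (j : ℕ) :
    modeParam p T j 0 = (p - 1) * (j * piPQ p p / T) ^ p := by
  rw [modeParam, piPQ_eq hp, Real.zero_rpow (by linarith), add_zero, mul_one]
  congr 3
  ring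

theorem exists_modeParam_eq {p T lam : ℝ} {j : ℕ} (hp : 1 < p) (hp2 : p ≤ 2) (hT : 0 < T)
    (hj : 1 ≤ j) (h : (p - 1) * (j * piPQ p p / T) ^ p < lam) :
    ∃ k ∈ Ioo (0 : ℝ) 1, modeParam p T j k = lam := by
  have hj' : (0 : ℝ) < j := by exact_mod_cast hj
  have hp0 : 0 < p := by linarith
  have hcont : ContinuousOn (modeParam p T j) (Ico 0 1) := by
    have hK := continuousOn_Kpq hp
    have hid : ContinuousOn (fun k : ℝ => k ^ p) (Ico 0 1) :=
      (continuous_id.rpow_const fun _ => Or.inr hp0.le).continuousOn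
    exact (continuousOn_const.mul (continuousOn_const.add hid)).mul
      (((continuousOn_const.mul hK).div_const T).rpow_const fun _ _ => Or.inr hp0.le)
  have htend : Tendsto (Kpq p p) (𝓝[<] 1) atTop := by
    have hlog : Tendsto (fun k : ℝ => -Real.log (1 - k) / p) (𝓝[<] 1) atTop := by
      refine Tendsto.atTop_div_const hp0 (tendsto_neg_atBot_atTop.comp
        (Real.tendsto_log_nhdsGT_zero.comp ?_))
      refine tendsto_nhdsWithin_iff.2 ⟨?_, ?_⟩
      · have : Tendsto (fun k : ℝ => 1 - k) (𝓝 1) (𝓝 (1 - 1)) :=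
          (continuous_const.sub continuous_id).tendsto 1
        rw [sub_self] at this
        exact this.mono_left nhdsWithin_le_nhds
      · filter_upwards [self_mem_nhdsWithin] with k hk
        exact sub_pos.2 (mem_Iio.1 hk)
    refine tendsto_atTop_mono' _ ?_ hlog
    filter_upwards [Ioo_mem_nhdsLT (zero_lt_one' ℝ)] with k hk
    exact Kpq_lower_bound hp hp2 hk.1 hk.2
  have htend' : Tendsto (fun k => (p - 1) * (2 * j * Kpq p p k / T) ^ p) (𝓝[<] 1) atTop :=
    ((tendsto_rpow_atTop hp0).comp ((htend.const_mul_atTop (by positivity)).atTop_div_const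
      hT)).const_mul_atTop (by linarith)
  obtain ⟨l, hl, hl01⟩ := ((htend'.eventually_ge_atTop lam).and
    (Ioo_mem_nhdsLT (zero_lt_one' ℝ))).exists
  have hle : lam ≤ modeParam p T j l := by
    refine hl.trans ?_
    have hK := Kpq_pos hp hl01.1.le hl01.2
    have : 0 ≤ l ^ p := Real.rpow_nonneg hl01.1.le _
    have h3 : 0 < (2 * j * Kpq p p l / T) ^ p := by positivity
    unfold modeParam
    gcongr
    nlinarith
  obtain ⟨k, hk, hke⟩ := intermediate_value_Icc hl01.1.le
    (hcont.mono fun x hx => ⟨hx.1, hx.2.trans_lt hl01.2⟩)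
    (show lam ∈ Icc (modeParam p T j 0) (modeParam p T j l) from
      ⟨by rw [modeParam_zero hp]; exact h.le, hle⟩)
  refine ⟨k, ⟨lt_of_le_of_ne hk.1 ?_, hk.2.trans_lt hl01.2⟩, hke⟩
  rintro rfl
  rw [modeParam_zero hp] at hke
  linarith

theorem modeParam_injOn {p T : ℝ} {j : ℕ} (hp : 1 < p) (hT : 0 < T) (hj : 1 ≤ j) :
    InjOn (modeParam p T j) (Ioo 0 1) :=
  StrictMonoOn.injOn fun _ hk _ hl hkl => modeParam_lt_of_lt hp hT hj hk.1.le hkl hl.2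

theorem IsTraj.neg {p lam a b : ℝ} {u v : ℝ → ℝ} (h : IsTraj p lam a b u v) :
    IsTraj p lam a b (fun t => -u t) (fun t => -v t) := by
  refine ⟨h.1.neg, h.2.neg, fun t ht => (h.3 t ht).neg, fun t ht => ?_⟩
  simp only [phi_neg, abs_neg]
  exact (h.4 t ht).neg.congr_deriv (by ring)

/-- A trajectory leaving the origin with positive velocity and returning to zero has velocity
strictly below the one of the heteroclinic connection. -/
theorem IsTraj.velocity_rpow_lt {p lam T : ℝ} {u v : ℝ → ℝ} (hp : 1 < p) (hp2 : p ≤ 2)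
    (hlam : 0 < lam) (hT : 0 < T) (h : IsTraj p lam 0 T u v)
    (hd : ∀ t ∈ Ioo 0 T, HasDerivAt u (v t) t) (h0 : u 0 = 0) (h1 : u T = 0) (hv : v 0 ≠ 0) :
    |v 0| ^ p < lam / (p - 1) / 2 := by
  have hp0 : p ≠ 0 := by linarith
  have hmu : 0 < lam / (p - 1) := div_pos hlam (by linarith)
  have hR : 0 < |v 0| ^ p := Real.rpow_pos_of_pos (abs_pos.2 hv) p
  have hE0 : energy p lam (u 0) (v 0) = |v 0| ^ p := by
    simp [energy, h0, Real.zero_rpow hp0]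
  obtain ⟨t, ht, hvt⟩ := exists_hasDerivAt_eq_zero hT h.cont_pos (h0.trans h1.symm) hd
  have hEt := h.energy_eq hp t (Ioo_subset_Icc_self ht)
  have hEt' := hEt
  rw [hE0, hvt, energy, abs_zero, Real.zero_rpow hp0, zero_add] at hEt'
  by_contra! hge
  have hx : |u t| ^ p = 1 := by
    have h2 : lam / (p - 1) * (|u t| ^ p - 1) ^ 2 ≤ 0 := by linarith
    have h3 : (|u t| ^ p - 1) ^ 2 ≤ 0 := by
      by_contra! hpos
      nlinarith [mul_pos hmu hpos]
    nlinarith [sq_nonneg (|u t| ^ p - 1)]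
  have hut : |u t| = 1 := by
    have := congrArg (· ^ p⁻¹) hx
    simpa [Real.rpow_rpow_inv (abs_nonneg (u t)) hp0] using this
  have huniq := (h.mono ht.1.le).unique hp hp2 ht.2.le (isTraj_const hut) rfl hvt
    (by rw [hEt, hE0]; exact hR.ne') T (right_mem_Icc.2 ht.2.le)
  rw [h1] at huniq
  simp [← huniq] at hut

/-- Any admissible pair of a parameter and an initial velocity comes from a modulus and a
frequency. -/
theorem exists_modulus_frequency {p mu w : ℝ} (hp : 1 < p) (hmu : 0 < mu) (hw : 0 < w)
    (h : w ^ p < mu / 2) :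
    ∃ k ∈ Ioo (0 : ℝ) 1, ∃ ω > 0, mu = (1 + k ^ p) * ω ^ p ∧ w = amplitude p k * ω := by
  have hp0 : p ≠ 0 := by linarith
  have hR : 0 < w ^ p := Real.rpow_pos_of_pos hw p
  set R := w ^ p with hRdef
  have hs0 : 0 < 1 - 2 * R / mu := by
    rw [sub_pos, div_lt_one hmu]; linarith
  have hs1 : 1 - 2 * R / mu < 1 := by
    have : 0 < 2 * R / mu := by positivity
    linarith
  set s := √(1 - 2 * R / mu) with hs
  have hss : s ^ 2 = 1 - 2 * R / mu := Real.sq_sqrt hs0.le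
  have hspos : 0 < s := Real.sqrt_pos.2 hs0
  have hslt : s < 1 := by nlinarith
  have hmuR : mu * (1 - s ^ 2) = 2 * R := by rw [hss]; field_simp; ring
  have hy0 : 0 < (1 - s) / (1 + s) := div_pos (by linarith) (by linarith)
  have hy1 : (1 - s) / (1 + s) < 1 := by rw [div_lt_one (by linarith)]; linarith
  have hk0 : 0 < ((1 - s) / (1 + s)) ^ p⁻¹ := Real.rpow_pos_of_pos hy0 _
  have hkp : (((1 - s) / (1 + s)) ^ p⁻¹) ^ p = (1 - s) / (1 + s) :=
    Real.rpow_inv_rpow hy0.le hp0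
  have hω : 0 < mu * (1 + s) / 2 := by positivity
  have hωp : ((mu * (1 + s) / 2) ^ p⁻¹) ^ p = mu * (1 + s) / 2 := Real.rpow_inv_rpow hω.le hp0
  have hω0 : 0 < (mu * (1 + s) / 2) ^ p⁻¹ := Real.rpow_pos_of_pos hω _
  refine ⟨_, ⟨hk0, Real.rpow_lt_one hy0.le hy1 (by positivity)⟩, _, hω0, ?_, ?_⟩
  · rw [hkp, hωp]
    field_simp
    ring
  · have ha := amplitude_pos (p := p) hk0
    rw [← Real.rpow_left_inj hw.le (by positivity) hp0, Real.mul_rpow ha.le hω0.le,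
      amplitude_rpow hp hk0, hkp, hωp, ← hRdef]
    field_simp
    linarith

theorem IsSolP.eq_zero_or_exists_mode {p T lam : ℝ} {sn : ℝ → ℝ → ℝ} {u : ℝ → ℝ} (hp : 1 < p)
    (hp2 : p ≤ 2) (hT : 0 < T) (hlam : 0 < lam) (hsn : ∀ k ∈ Ico (0 : ℝ) 1, IsSn p k (sn k))
    (h : IsSolP p p T lam u) :
    (∀ t ∈ Icc 0 T, u t = 0) ∨
    ∃ j : ℕ, 1 ≤ j ∧ ∃ k ∈ Ioo (0 : ℝ) 1, lam = modeParam p T j k ∧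
      ((∀ t ∈ Icc 0 T, u t = amplitude p k * sn k (2 * j * Kpq p p k / T * t)) ∨
        ∀ t ∈ Icc 0 T, u t = -(amplitude p k * sn k (2 * j * Kpq p p k / T * t))) := by
  have hp0 : p ≠ 0 := by linarith
  have pos : ∀ u v : ℝ → ℝ, IsTraj p lam 0 T u v → (∀ t ∈ Ioo 0 T, HasDerivAt u (v t) t) →
      u 0 = 0 → u T = 0 → 0 < v 0 → ∃ j : ℕ, 1 ≤ j ∧ ∃ k ∈ Ioo (0 : ℝ) 1,
        lam = modeParam p T j k ∧
        ∀ t ∈ Icc 0 T, u t = amplitude p k * sn k (2 * j * Kpq p p k / T * t) := by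
    intro u v htraj hd h0 h1 hv
    have hlt := htraj.velocity_rpow_lt hp hp2 hlam hT hd h0 h1 hv.ne'
    rw [abs_of_pos hv] at hlt
    obtain ⟨k, hk, ω, hω, hmu, hva⟩ :=
      exists_modulus_frequency hp (div_pos hlam (by linarith)) hv hlt
    have hS := hsn k ⟨hk.1.le, hk.2⟩
    have hlam' : lam = (p - 1) * (1 + k ^ p) * ω ^ p := by
      rw [mul_assoc, ← hmu, mul_div_cancel₀ _ (by linarith : p - 1 ≠ 0)]
    have hK := Kpq_pos hp hk.1.le hk.2
    have htraj' := hS.isTraj_scaled hp hk.1 hk.2 hω 0 T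
    rw [← hlam'] at htraj'
    have heq := htraj.unique hp hp2 hT.le htraj' (by simp [h0, hS.apply_zero])
      (by simp [hS.deriv_zero hp hk.1.le hk.2, hva]) (by
        simp [energy, h0, Real.zero_rpow hp0, (Real.rpow_pos_of_pos (abs_pos.2 hv.ne') p).ne'])
    have hzero : sn k (ω * T) = 0 := by
      have := heq T (right_mem_Icc.2 hT.le)
      rw [h1] at this
      simpa [(amplitude_pos hk.1).ne'] using this.symm
    obtain ⟨n, hn⟩ := hS.exists_int_of_eq_zero hp hk.1.le hk.2 hzero
    have hnpos : 0 < n := by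
      have : (0 : ℝ) < n * (2 * Kpq p p k) := hn ▸ mul_pos hω hT
      exact_mod_cast pos_of_mul_pos_left this (by positivity)
    lift n to ℕ using hnpos.le
    have hω' : ω = 2 * n * Kpq p p k / T := by
      rw [eq_div_iff hT.ne', hn]
      push_cast
      ring
    subst hω'
    exact ⟨n, by exact_mod_cast hnpos, k, hk, hlam', heq⟩
  obtain ⟨v, htraj, hd, h0, h1⟩ := h.exists_isTraj hp hT
  rcases lt_trichotomy (v 0) 0 with hv | hv | hv
  · obtain ⟨j, hj, k, hk, hl, he⟩ := pos (fun t => -u t) (fun t => -v t) htraj.neg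
      (fun t ht => (hd t ht).neg) (by simp [h0]) (by simp [h1]) (by linarith)
    exact Or.inr ⟨j, hj, k, hk, hl, Or.inr fun t ht => by linarith [he t ht]⟩
  · exact Or.inl (htraj.eq_zero_of_energy hp hlam h0 hv)
  · obtain ⟨j, hj, k, hk, hl, he⟩ := pos u v htraj hd h0 h1 hv
    exact Or.inr ⟨j, hj, k, hk, hl, Or.inl he⟩

theorem stmt18 (p T : ℝ) (hp1 : 1 < p) (hp2 : p ≤ 2) (hT : 0 < T)
    (sn : ℝ → ℝ → ℝ)
    (hsn_inv : ∀ k ∈ Ico (0:ℝ) 1, ∀ σ ∈ Icc (0:ℝ) 1, sn k (arcsnPQ p p k σ) = σ)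
    (hsn_refl : ∀ k ∈ Ico (0:ℝ) 1, ∀ t ∈ Icc (Kpq p p k) (2 * Kpq p p k),
      sn k t = sn k (2 * Kpq p p k - t))
    (hsn_odd : ∀ k ∈ Ico (0:ℝ) 1, ∀ t : ℝ, sn k (-t) = - sn k t)
    (hsn_per : ∀ k ∈ Ico (0:ℝ) 1, ∀ t : ℝ, sn k (t + 4 * Kpq p p k) = sn k t)
    (lam : ℝ) (hlam : 0 < lam) :
    let lamj := fun (j : ℕ) (k : ℝ) =>
      p / (p / (p - 1)) * (1 + k ^ p) * (2 * k ^ p / (1 + k ^ p)) ^ (p / p - 1) *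
        (2 * (j : ℝ) * Kpq p p k / T) ^ p
    let uj := fun (j : ℕ) (k : ℝ) (t : ℝ) =>
      (2 * k ^ p / (1 + k ^ p)) ^ (1 / p) * sn k (2 * (j : ℝ) * Kpq p p k * t / T)
    (lam ≤ p / (p / (p - 1)) * (piPQ p p / T) ^ p →
      IsSolP p p T lam (fun _ => 0) ∧
      ∀ u : ℝ → ℝ, IsSolP p p T lam u → ∀ t ∈ Icc (0:ℝ) T, u t = 0) ∧
    (∀ n : ℕ, 1 ≤ n →
      p / (p / (p - 1)) * ((n : ℝ) * piPQ p p / T) ^ p < lam →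
      lam ≤ p / (p / (p - 1)) * (((n : ℝ) + 1) * piPQ p p / T) ^ p →
      ∃ ks : ℕ → ℝ,
        (∀ j : ℕ, 1 ≤ j → j ≤ n → ks j ∈ Ioo (0:ℝ) 1) ∧
        (∀ i j : ℕ, 1 ≤ i → i < j → j ≤ n → ks j < ks i) ∧
        (∀ j : ℕ, 1 ≤ j → j ≤ n →
          lam = lamj j (ks j) ∧
          ∀ k' ∈ Ioo (0:ℝ) 1, lam = lamj j k' → k' = ks j) ∧
        IsSolP p p T lam (fun _ => 0) ∧
        (∀ j : ℕ, 1 ≤ j → j ≤ n →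
          IsSolP p p T lam (uj j (ks j)) ∧
          IsSolP p p T lam (fun t => -(uj j (ks j) t))) ∧
        (∀ u : ℝ → ℝ, IsSolP p p T lam u →
          (∀ t ∈ Icc (0:ℝ) T, u t = 0) ∨
          ∃ j : ℕ, 1 ≤ j ∧ j ≤ n ∧
            ((∀ t ∈ Icc (0:ℝ) T, u t = uj j (ks j) t) ∨
             (∀ t ∈ Icc (0:ℝ) T, u t = -(uj j (ks j) t))))) := by
  intro lamj uj
  have hS : ∀ k ∈ Ico (0 : ℝ) 1, IsSn p k (sn k) := fun k hk =>
    ⟨hsn_inv k hk, hsn_refl k hk, hsn_odd k hk, hsn_per k hk⟩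
  have hp0 : p ≠ 0 := by linarith
  have hp1' : p - 1 ≠ 0 := by linarith
  have hpp : p / (p / (p - 1)) = p - 1 := by field_simp
  have hlamj : lamj = modeParam p T := by
    funext j k
    simp only [lamj]
    rw [hpp, div_self hp0, sub_self, Real.rpow_zero, mul_one, modeParam]
  have huj : uj = fun (j : ℕ) k t => amplitude p k * sn k (2 * j * Kpq p p k / T * t) := by
    funext j k t
    simp only [uj]
    rw [amplitude, div_mul_eq_mul_div (2 * (j : ℝ) * Kpq p p k) T t]
  have hlow : ∀ {j : ℕ} {k : ℝ}, 1 ≤ j → k ∈ Ioo (0 : ℝ) 1 →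
      (p - 1) * (j * piPQ p p / T) ^ p < modeParam p T j k := fun hj hk => by
    rw [← modeParam_zero hp1]
    exact modeParam_lt_of_lt hp1 hT hj le_rfl hk.1 hk.2
  have hmono : ∀ {i j : ℕ}, i ≤ j →
      (p - 1) * (i * piPQ p p / T) ^ p ≤ (p - 1) * (j * piPQ p p / T) ^ p := fun hij => by
    rw [← modeParam_zero hp1, ← modeParam_zero hp1]
    rcases hij.eq_or_lt with rfl | hlt
    · exact le_rfl
    · exact (modeParam_lt_of_mode_lt hp1 hT hlt le_rfl one_pos).le
  rw [hlamj, huj, hpp]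
  refine ⟨fun hle => ⟨isSolP_zero p p T lam, fun u hu => ?_⟩, fun n hn hgt hle => ?_⟩
  · refine (hu.eq_zero_or_exists_mode hp1 hp2 hT hlam hS).resolve_right ?_
    rintro ⟨j, hj, k, hk, hl, -⟩
    have h1 := hlow hj hk
    have h2 := hmono hj
    rw [Nat.cast_one, one_mul] at h2
    linarith
  · have hex : ∀ j : ℕ, ∃ k, 1 ≤ j → j ≤ n → k ∈ Ioo (0 : ℝ) 1 ∧ modeParam p T j k = lam := by
      intro j
      by_cases hj : 1 ≤ j ∧ j ≤ n
      · obtain ⟨k, hk, he⟩ := exists_modeParam_eq hp1 hp2 hT hj.1 ((hmono hj.2).trans_lt hgt)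
        exact ⟨k, fun _ _ => ⟨hk, he⟩⟩
      · exact ⟨0, fun h1 h2 => absurd ⟨h1, h2⟩ hj⟩
    choose ks hks using hex
    have huniq : ∀ j : ℕ, 1 ≤ j → j ≤ n → ∀ k' ∈ Ioo (0 : ℝ) 1, lam = modeParam p T j k' →
        k' = ks j := fun j h1 h2 k' hk' he =>
      modeParam_injOn hp1 hT h1 hk' (hks j h1 h2).1 (he.symm.trans (hks j h1 h2).2.symm)
    have hsol : ∀ j : ℕ, 1 ≤ j → j ≤ n → IsSolP p p T lam
        (fun t => amplitude p (ks j) * sn (ks j) (2 * j * Kpq p p (ks j) / T * t)) := by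
      intro j h1 h2
      obtain ⟨hk, he⟩ := hks j h1 h2
      rw [← he]
      exact (hS _ ⟨hk.1.le, hk.2⟩).isSolP_mode hp1 hk.1 hk.2 hT h1
    refine ⟨ks, fun j h1 h2 => (hks j h1 h2).1, fun i j h1 hij h2 => ?_,
      fun j h1 h2 => ⟨(hks j h1 h2).2.symm, huniq j h1 h2⟩, isSolP_zero p p T lam,
      fun j h1 h2 => ⟨hsol j h1 h2, (hsol j h1 h2).neg⟩, fun u hu => ?_⟩
    · obtain ⟨hki, hei⟩ := hks i h1 (hij.le.trans h2)
      obtain ⟨hkj, hej⟩ := hks j (h1.trans hij.le) h2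
      by_contra! hge
      have h3 := modeParam_lt_of_mode_lt hp1 hT hij hkj.1.le hkj.2
      rcases hge.eq_or_lt with he | hlt
      · rw [← he] at h3 hej
        linarith
      · have h4 := modeParam_lt_of_lt hp1 hT h1 hki.1.le hlt hkj.2
        linarith
    · refine (hu.eq_zero_or_exists_mode hp1 hp2 hT hlam hS).imp_right ?_
      rintro ⟨j, hj, k, hk, hl, he⟩
      have hjn : j ≤ n := by
        by_contra! hlt
        have h1 := hlow hj hk
        have h2 := hmono (Nat.succ_le_of_lt hlt)
        rw [Nat.succ_eq_add_one, Nat.cast_add_one] at h2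
        linarith
      obtain rfl := huniq j hj hjn k hk hl
      exact ⟨j, hj, hjn, he⟩
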